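/- Let 1 < p < 2, p ≤ q, assume (p−1)²(q−1) > 1, set κ₁ = p−1, κ₂ = q(p−1)−1, and let a_j and ℓ be as in the context. Suppose u₁, u₁* ∈ Z²(κ₁) satisfy u₁ − u₁* ∈ Z²(κ₁a_{ℓ+1}) and ‖u₁‖_{Z²(κ₁)} + ‖u₁*‖_{Z²(κ₁)} ≤ C ε with 0 < ε ≤ 1. Then, with H(w,w*) = |∂_t w|^q − |∂_t w*|^q, ‖R(H(u₁,u₁*))‖_{Z¹(a_{ℓ+2})} ≤ C′ ε^{q−1} ‖u₁ − u₁*‖_{Z¹(κ₁a_{ℓ+1})} and ‖R(H(u₁,u₁*))‖_{Z²(a_{ℓ+2})} ≤ C′ ε^{q−1} ‖u₁ − u₁*‖_{Z²(κ₁a_{ℓ+1})}, where C′ depends only on p, q and C. -/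

import Mathlib

open Real MeasureTheory Filter

noncomputable section

/-- Partial derivative with respect to the first (radial) variable. -/
def pdr (u : ℝ → ℝ → ℝ) : ℝ → ℝ → ℝ := fun r t => deriv (fun r' => u r' t) r

/-- Partial derivative with respect to the second (time) variable. -/
def pdt (u : ℝ → ℝ → ℝ) : ℝ → ℝ → ℝ := fun r t => deriv (fun t' => u r t') t

/-- `[u(r,t)]₁ = |u| + r (|∂_r u| + |∂_t u|)`. -/
def bracket1 (u : ℝ → ℝ → ℝ) (r t : ℝ) : ℝ :=
  |u r t| + r * (|pdr u r t| + |pdt u r t|)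

/-- `[u(r,t)]₂ = |u| + (1+r)(|∂_r u| + |∂_t u|) + r (|∂_r² u| + |∂_r∂_t u| + |∂_t² u|)`. -/
def bracket2 (u : ℝ → ℝ → ℝ) (r t : ℝ) : ℝ :=
  |u r t| + (1 + r) * (|pdr u r t| + |pdt u r t|) +
    r * (|pdr (pdr u) r t| + |pdr (pdt u) r t| + |pdt (pdt u) r t|)

def bracketS (s : ℕ) (u : ℝ → ℝ → ℝ) (r t : ℝ) : ℝ :=
  if s = 1 then bracket1 u r t else bracket2 u r t

/-- Membership in the class `X^s`: `u ∈ C^{s-1}(ℝ × [0,∞))`, `r u ∈ C^s(ℝ × [0,∞))`,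
and `u` is even in `r`. -/
def memX (s : ℕ) (u : ℝ → ℝ → ℝ) : Prop :=
  ContDiffOn ℝ ((s - 1 : ℕ) : ℕ∞) (fun z : ℝ × ℝ => u z.1 z.2) (Set.univ ×ˢ Set.Ici (0:ℝ)) ∧
  ContDiffOn ℝ ((s : ℕ) : ℕ∞) (fun z : ℝ × ℝ => z.1 * u z.1 z.2) (Set.univ ×ˢ Set.Ici (0:ℝ)) ∧
  ∀ r t : ℝ, 0 ≤ t → u (-r) t = u r t

/-- The set of values whose supremum is `‖u‖_{X^s(ν)}`. -/
def XSet (s : ℕ) (ν : ℝ) (u : ℝ → ℝ → ℝ) : Set ℝ :=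
  {x | ∃ r t : ℝ, 0 < r ∧ 0 ≤ t ∧ x = bracketS s u r t * (1 + |r - t|) ^ ν}

/-- `‖u‖_{X^s(ν)}`. -/
def Xnorm (s : ℕ) (ν : ℝ) (u : ℝ → ℝ → ℝ) : ℝ := sSup (XSet s ν u)

/-- `u ∈ X^s(ν)`. -/
def memXnu (s : ℕ) (ν : ℝ) (u : ℝ → ℝ → ℝ) : Prop := memX s u ∧ BddAbove (XSet s ν u)

/-- The set of values whose supremum is `‖u‖_{Z^s(ν)}`. -/
def ZSet (s : ℕ) (ν : ℝ) (u : ℝ → ℝ → ℝ) : Set ℝ :=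
  {x | ∃ r t : ℝ, 0 < r ∧ 0 ≤ t ∧
    x = bracketS s u r t * (1 + r + t) ^ (ν - 1) * (1 + |r - t|)}

/-- `‖u‖_{Z^s(ν)}`. -/
def Znorm (s : ℕ) (ν : ℝ) (u : ℝ → ℝ → ℝ) : ℝ := sSup (ZSet s ν u)

/-- `u ∈ Z^s(ν)`. -/
def memZnu (s : ℕ) (ν : ℝ) (u : ℝ → ℝ → ℝ) : Prop := memX s u ∧ BddAbove (ZSet s ν u)

/-- `|||f⃗(r)|||`. -/
def tripleNorm (f g : ℝ → ℝ) (r : ℝ) : ℝ :=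
  |f r| + (1 + r) * (|deriv f r| + |g r|) + r * (|deriv (deriv f) r| + |deriv g r|)

def tnorm (fg : (ℝ → ℝ) × (ℝ → ℝ)) (r : ℝ) : ℝ := tripleNorm fg.1 fg.2 r

/-- `f⃗ ∈ Y_ν(ε)`. -/
def memY (ν ε : ℝ) (fg : (ℝ → ℝ) × (ℝ → ℝ)) : Prop :=
  ContDiff ℝ 1 fg.1 ∧ Continuous fg.2 ∧
  (∀ r : ℝ, fg.1 (-r) = fg.1 r) ∧ (∀ r : ℝ, fg.2 (-r) = fg.2 r) ∧
  ContDiff ℝ 2 (fun r : ℝ => r * fg.1 r) ∧ ContDiff ℝ 1 (fun r : ℝ => r * fg.2 r) ∧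
  ∀ r : ℝ, 0 < r → (1 + r) ^ ν * tnorm fg r ≤ ε

/-- Solution operator `K[f⃗]` of the radial homogeneous wave equation. -/
def Kop (fg : (ℝ → ℝ) × (ℝ → ℝ)) : ℝ → ℝ → ℝ := fun r t =>
  (1 / (2 * r)) * ((∫ l in (r - t)..(r + t), l * fg.2 l) +
    deriv (fun s : ℝ => ∫ l in (r - s)..(r + s), l * fg.1 l) t)

/-- Duhamel operator `L(F)` for the initial value problem with zero data. -/
def Lop (F : ℝ → ℝ → ℝ) : ℝ → ℝ → ℝ := fun r t =>
  (1 / (2 * r)) * ∫ s in (0:ℝ)..t, (∫ l in (r - (t - s))..(r + (t - s)), l * F l s)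

/-- Operator `R(F)` associated with the final value problem. -/
def Rop (F : ℝ → ℝ → ℝ) : ℝ → ℝ → ℝ := fun r t =>
  (1 / (2 * r)) * ∫ s in Set.Ioi t, (∫ l in ((s - t) - r)..((s - t) + r), l * F l s)

/-- Values whose supremum is `M₀(F)`. -/
def M0Set (α β γ δ : ℝ) (F : ℝ → ℝ → ℝ) : Set ℝ :=
  {x | ∃ r t : ℝ, 0 < r ∧ 0 ≤ t ∧
    x = |F r t| * r ^ α * (1 + r) ^ β * (1 + r + t) ^ γ * (1 + |r - t|) ^ δ}

/-- Values whose supremum is the second summand of `M₁(F)`. -/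
def M1Set (α β γ δ : ℝ) (F : ℝ → ℝ → ℝ) : Set ℝ :=
  {x | ∃ r t : ℝ, 0 < r ∧ 0 ≤ t ∧
    x = |pdr F r t| * r ^ (α + 1) * (1 + r) ^ (β - 1) * (1 + r + t) ^ γ * (1 + |r - t|) ^ δ}

/-- `M_s(F)` for `s = 0, 1`. -/
def Mnorm (s : ℕ) (α β γ δ : ℝ) (F : ℝ → ℝ → ℝ) : ℝ :=
  if s = 0 then sSup (M0Set α β γ δ F)
  else sSup (M0Set α β γ δ F) + sSup (M1Set α β γ δ F)

/-- Finiteness of `M_s(F)`. -/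
def MFinite (s : ℕ) (α β γ δ : ℝ) (F : ℝ → ℝ → ℝ) : Prop :=
  BddAbove (M0Set α β γ δ F) ∧ (s = 0 ∨ BddAbove (M1Set α β γ δ F))

/-- Energy norm `‖w(t)‖_E` of the radial function `w(|x|,t)` on `ℝ³`. -/
def energy (w : ℝ → ℝ → ℝ) (t : ℝ) : ℝ :=
  Real.sqrt ((1 / 2) * ∫ x : EuclideanSpace ℝ (Fin 3),
    ((pdt w ‖x‖ t) ^ 2 + (pdr w ‖x‖ t) ^ 2))

/-- The nonlinearity `|∂_t u|^p`. -/
def NLt (p : ℝ) (u : ℝ → ℝ → ℝ) : ℝ → ℝ → ℝ := fun r t => |pdt u r t| ^ p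

/-- `(u₁,u₂)` solves the radially symmetric system (S). -/
def solvesS (p q : ℝ) (u₁ u₂ : ℝ → ℝ → ℝ) : Prop :=
  ∀ r t : ℝ, 0 < r → 0 ≤ t →
    pdt (pdt u₁) r t - (pdr (pdr u₁) r t + (2 / r) * pdr u₁ r t) = |pdt u₂ r t| ^ p ∧
    pdt (pdt u₂) r t - (pdr (pdr u₂) r t + (2 / r) * pdr u₂ r t) = |pdt u₁ r t| ^ q

/-- Initial data `(u(·,0), ∂_t u(·,0))` of a function `u(r,t)`. -/
def datum (u : ℝ → ℝ → ℝ) : (ℝ → ℝ) × (ℝ → ℝ) := (fun r => u r 0, fun r => pdt u r 0)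

/-- The sequence `a₀ = 1`, `a_{j+1} = κ₁ (a_j - 1) + κ₂`. -/
def aseq (κ₁ κ₂ : ℝ) : ℕ → ℝ
  | 0 => 1
  | n + 1 => κ₁ * (aseq κ₁ κ₂ n - 1) + κ₂

/-- Auxiliary iteration producing the pairs `((w_j, v_j), (w_{j+1}, v_{j+1}))`. -/
def iterAux (p q : ℝ) (fg1 fg2 : (ℝ → ℝ) × (ℝ → ℝ)) :
    ℕ → ((ℝ → ℝ → ℝ) × (ℝ → ℝ → ℝ)) × ((ℝ → ℝ → ℝ) × (ℝ → ℝ → ℝ))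
  | 0 =>
    ((Kop fg1, Kop fg2),
     (Kop fg1 + Lop (NLt p (Kop fg2)),
      Kop fg2 + Rop (NLt q (Kop fg1 + Lop (NLt p (Kop fg2))))))
  | n + 1 =>
    let prev := iterAux p q fg1 fg2 n
    let wnext := prev.2.1 + Lop (NLt p prev.2.2 - NLt p prev.1.2)
    (prev.2, (wnext, prev.2.2 + Rop (NLt q wnext - NLt q prev.2.1)))

/-- The iterate `w_j`. -/
def witer (p q : ℝ) (fg1 fg2 : (ℝ → ℝ) × (ℝ → ℝ)) (j : ℕ) : ℝ → ℝ → ℝ :=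
  (iterAux p q fg1 fg2 j).1.1

/-- The iterate `v_j`. -/
def viter (p q : ℝ) (fg1 fg2 : (ℝ → ℝ) × (ℝ → ℝ)) (j : ℕ) : ℝ → ℝ → ℝ :=
  (iterAux p q fg1 fg2 j).1.2

/-- The starred iterates `(w_j^*, v_j^*)` built from a solution `(u₁,u₂)`. -/
def starIter (p q : ℝ) (φ1 : (ℝ → ℝ) × (ℝ → ℝ)) (u₁ u₂ : ℝ → ℝ → ℝ) :
    ℕ → (ℝ → ℝ → ℝ) × (ℝ → ℝ → ℝ)
  | 0 => (Kop φ1, u₂ - Rop (NLt q u₁))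
  | n + 1 =>
    let w := Kop φ1 + Lop (NLt p (starIter p q φ1 u₁ u₂ n).2)
    (w, (u₂ - Rop (NLt q u₁)) + Rop (NLt q w))

/-- The quantity `d₁(w, 0) = ‖w‖_{Z²(κ₁ a_{ℓ+1})} + ‖w‖_{Z¹(κ₁ a_{ℓ+1})}^{p-1}` (applied to
differences). -/
def dOne (p q : ℝ) (ℓ : ℕ) (w : ℝ → ℝ → ℝ) : ℝ :=
  Znorm 2 ((p - 1) * aseq (p - 1) (q * (p - 1) - 1) (ℓ + 1)) w +
    Znorm 1 ((p - 1) * aseq (p - 1) (q * (p - 1) - 1) (ℓ + 1)) w ^ (p - 1)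

/-- The quantity `d₂(w, 0) = ‖w‖_{Z²(a_{ℓ+1})} + ‖w‖_{Z¹(a_{ℓ+1})}^{p-1}` (applied to
differences). -/
def dTwo (p q : ℝ) (ℓ : ℕ) (w : ℝ → ℝ → ℝ) : ℝ :=
  Znorm 2 (aseq (p - 1) (q * (p - 1) - 1) (ℓ + 1)) w +
    Znorm 1 (aseq (p - 1) (q * (p - 1) - 1) (ℓ + 1)) w ^ (p - 1)

/-- Membership in the metric ball `D_ε` around `(w_{ℓ+1}, v_{ℓ+1})`. -/
def memD (p q ε : ℝ) (ℓ : ℕ) (fg1 fg2 : (ℝ → ℝ) × (ℝ → ℝ)) (u₁ u₂ : ℝ → ℝ → ℝ) : Prop :=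
  memX 2 u₁ ∧ memX 2 u₂ ∧
  BddAbove (ZSet 2 ((p - 1) * aseq (p - 1) (q * (p - 1) - 1) (ℓ + 1))
    (u₁ - witer p q fg1 fg2 (ℓ + 1))) ∧
  BddAbove (ZSet 1 ((p - 1) * aseq (p - 1) (q * (p - 1) - 1) (ℓ + 1))
    (u₁ - witer p q fg1 fg2 (ℓ + 1))) ∧
  BddAbove (ZSet 2 (aseq (p - 1) (q * (p - 1) - 1) (ℓ + 1))
    (u₂ - viter p q fg1 fg2 (ℓ + 1))) ∧
  BddAbove (ZSet 1 (aseq (p - 1) (q * (p - 1) - 1) (ℓ + 1))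
    (u₂ - viter p q fg1 fg2 (ℓ + 1))) ∧
  dOne p q ℓ (u₁ - witer p q fg1 fg2 (ℓ + 1)) + dTwo p q ℓ (u₂ - viter p q fg1 fg2 (ℓ + 1))
    ≤ ε ^ ((p - 1) * (q + (ℓ : ℝ) * (p + q - 2)))

section Helpers
open Topology
set_option linter.unusedSectionVars false

lemma hasDerivAt_integral_param (m : ℝ → ℝ → ℝ) (m' bd : ℝ → ℝ) (t0 : ℝ) (S : Set ℝ)
    (hbd : Integrable bd) (hmeas : ∀ t, AEStronglyMeasurable (fun s => m s t))
    (hint : Integrable (fun s => m s t0))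
    (hlip : ∀ s t, |m s t - m s t0| ≤ bd s * |t - t0|)
    (hd : ∀ᵐ s, HasDerivAt (m s) (m' s) t0) :
    HasDerivAt (fun t => ∫ s in S, m s t) (∫ s in S, m' s) t0 := by
  have hm' : AEStronglyMeasurable m' := by
    refine aestronglyMeasurable_of_tendsto_ae (u := atTop)
      (f := fun (n : ℕ) s => slope (m s) t0 (t0 + 1 / ((n : ℝ) + 1))) ?_ ?_
    · intro n
      simp only [slope_def_field]
      exact ((hmeas _).sub (hmeas _)).mul aestronglyMeasurable_const
    · filter_upwards [hd] with s hs
      refine (hasDerivAt_iff_tendsto_slope.1 hs).comp ?_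
      refine tendsto_nhdsWithin_iff.2 ⟨?_, ?_⟩
      · simpa using (tendsto_one_div_add_atTop_nhds_zero_nat (𝕜 := ℝ)).const_add t0
      · refine Eventually.of_forall fun n => ?_
        simp only [Set.mem_compl_iff, Set.mem_singleton_iff]
        have : (0:ℝ) < 1 / ((n : ℝ) + 1) := by positivity
        linarith
  have key := hasFDerivAt_integral_of_dominated_loc_of_lip' (𝕜 := ℝ) (μ := volume.restrict S)
    (F := fun t s => m s t) (x₀ := t0) (s := Set.univ) (bound := bd)
    (F' := fun s => ContinuousLinearMap.toSpanSingleton ℝ (m' s)) univ_mem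
    (fun t _ => (hmeas t).restrict) hint.restrict
    ((ContinuousLinearMap.toSpanSingletonCLE (𝕜 := ℝ) (E := ℝ)).continuous.comp_aestronglyMeasurable hm'.restrict)
    (Eventually.of_forall fun s t _ => by simpa [Real.norm_eq_abs] using hlip s t) hbd.restrict
    (ae_restrict_of_ae (hd.mono fun s hs => hs.hasFDerivAt))
  have h2 := key.2.hasDerivAt
  refine h2.congr_deriv ?_
  rw [ContinuousLinearMap.integral_apply key.1]
  simp

lemma hasDerivAt_integral_Ioi_param (m : ℝ → ℝ → ℝ) (m' bd : ℝ → ℝ) (t0 : ℝ)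
    (hbd : Integrable bd) (hmeas : ∀ t, AEStronglyMeasurable (fun s => m s t))
    (hint : Integrable (fun s => m s t0))
    (hlip : ∀ s t, |m s t - m s t0| ≤ bd s * |t - t0|)
    (hd : ∀ s, HasDerivAt (m s) (m' s) t0)
    (hc : ContinuousAt (fun s => m s t0) t0) :
    HasDerivAt (fun t => ∫ s in Set.Ioi t, m s t) (-(m t0 t0) + ∫ s in Set.Ioi t0, m' s) t0 := by
  set n : ℝ → ℝ → ℝ := fun s t => (Set.Ioi t).indicator (fun s => m s t - m s t0) s with hn
  set n' : ℝ → ℝ := (Set.Ioi t0).indicator m' with hn'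
  have hintt : ∀ t, Integrable (fun s => m s t - m s t0) := by
    intro t
    refine Integrable.mono' (hbd.mul_const |t - t0|) ((hmeas t).sub (hmeas t0)) ?_
    exact Eventually.of_forall fun s => by simpa [Real.norm_eq_abs] using hlip s t
  have hbd0 : ∀ s, 0 ≤ bd s := by
    intro s
    have := (abs_nonneg _).trans (hlip s (t0 + 1))
    simpa using this
  have h1 : HasDerivAt (fun t => ∫ s in Set.univ, n s t) (∫ s in Set.univ, n' s) t0 := by
    refine hasDerivAt_integral_param n n' bd t0 Set.univ hbd ?_ ?_ ?_ ?_
    · intro t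
      exact ((hintt t).aestronglyMeasurable).indicator measurableSet_Ioi
    · have : (fun s => n s t0) = fun _ => 0 := by
        ext s; simp [hn]
      rw [this]; simp
    · intro s t
      have : n s t0 = 0 := by simp [hn]
      rw [this, sub_zero]
      by_cases hs : s ∈ Set.Ioi t
      · simp only [hn, Set.indicator_of_mem hs]; exact hlip s t
      · simp only [hn, Set.indicator_of_notMem hs]
        rw [abs_zero]; exact mul_nonneg (hbd0 s) (abs_nonneg _)
    · have : ∀ᵐ s : ℝ, s ≠ t0 := by
        simp [ae_iff]
      filter_upwards [this] with s hs
      rcases lt_or_gt_of_ne hs with h | h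
      · have e1 : n' s = 0 := by simp [hn', not_lt.2 h.le]
        rw [e1]
        refine (hasDerivAt_const t0 (0:ℝ)).congr_of_eventuallyEq ?_
        filter_upwards [lt_mem_nhds h] with t ht
        simp [hn, not_lt.2 ht.le]
      · have e1 : n' s = m' s := by simp [hn', h]
        rw [e1]
        refine ((hd s).sub_const (m s t0)).congr_of_eventuallyEq ?_
        filter_upwards [gt_mem_nhds h] with t ht
        simp [hn, ht]
  have h2 : HasDerivAt (fun t => ∫ s in Set.Ioi t, m s t0) (-(m t0 t0)) t0 := by
    have h3 : HasDerivAt (fun t => ∫ s in t0..t, m s t0) (m t0 t0) t0 := by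
      refine intervalIntegral.integral_hasDerivAt_right (by simp) ?_ hc
      exact ⟨Set.univ, univ_mem, hint.aestronglyMeasurable.restrict⟩
    have h4 : (fun t => ∫ s in Set.Ioi t, m s t0) = fun t => (∫ s in Set.Ioi t0, m s t0) - ∫ s in t0..t, m s t0 := by
      ext t
      rw [← intervalIntegral.integral_Ioi_sub_Ioi' hint.integrableOn hint.integrableOn]
      ring
    rw [h4]
    exact h3.const_sub _
  have h5 := h2.add h1
  have e6 : (fun t => ∫ s in Set.Ioi t, m s t) =
      (fun t => ∫ s in Set.Ioi t, m s t0) + fun t => ∫ s in Set.univ, n s t := by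
    ext t
    simp only [Pi.add_apply]
    simp only [hn, Measure.restrict_univ]
    rw [integral_indicator measurableSet_Ioi, ← integral_add hint.integrableOn (hintt t).integrableOn]
    simp
  rw [e6]
  refine h5.congr_deriv ?_
  · simp only [hn', Measure.restrict_univ]
    rw [integral_indicator measurableSet_Ioi]

structure GoodG (b K : ℝ) (G G' : ℝ → ℝ → ℝ) : Prop where
  b1 : 1 < b
  odd : ∀ l s, G (-l) s = - G l s
  der : ∀ l s, HasDerivAt (fun x => G x s) (G' l s) l
  bd : ∀ l s, |G l s| ≤ K * (1 + |s|) ^ (-b)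
  bd' : ∀ l s, |G' l s| ≤ K * (1 + |s|) ^ (-b)
  meas : Measurable (Function.uncurry G)
  cont : ∀ ρ t, 0 < t → ContinuousAt (fun s => G (s - t + ρ) s) t

def Pint (G : ℝ → ℝ → ℝ) (ρ t : ℝ) : ℝ := ∫ s in Set.Ioi t, G (s - t + ρ) s

def Vint (G : ℝ → ℝ → ℝ) (r t : ℝ) : ℝ :=
  ∫ s in Set.Ioi t, ∫ l in ((s - t) - r)..((s - t) + r), G l s

namespace GoodG
variable {b K : ℝ} {G G' : ℝ → ℝ → ℝ}

lemma ibd (h : GoodG b K G G') : Integrable (fun s : ℝ => K * (1 + |s|) ^ (-b)) := by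
  have := integrable_one_add_norm (E := ℝ) (μ := volume) (r := b) (by simpa using h.b1)
  simpa [Real.norm_eq_abs] using this.const_mul K

lemma contl (h : GoodG b K G G') (s : ℝ) : Continuous (fun x => G x s) :=
  continuous_iff_continuousAt.2 fun l => (h.der l s).continuousAt

lemma measG (h : GoodG b K G G') (f : ℝ → ℝ) (hf : Measurable f) :
    AEStronglyMeasurable (fun s => G (f s) s) :=
  (h.meas.comp (hf.prodMk measurable_id)).aestronglyMeasurable

lemma intG (h : GoodG b K G G') (f : ℝ → ℝ) (hf : Measurable f) :
    Integrable (fun s => G (f s) s) :=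
  h.ibd.mono' (h.measG f hf) (Eventually.of_forall fun s => by simpa using h.bd _ _)

lemma lipG (h : GoodG b K G G') (s x y : ℝ) : |G x s - G y s| ≤ K * (1 + |s|) ^ (-b) * |x - y| := by
  have := Convex.norm_image_sub_le_of_norm_hasDerivWithin_le (s := Set.univ)
    (f := fun x => G x s) (f' := fun x => G' x s) (x := y) (y := x)
    (C := K * (1 + |s|) ^ (-b))
    (fun x _ => (h.der x s).hasDerivWithinAt) (fun x _ => by simpa using h.bd' x s)
    convex_univ trivial trivial
  simpa using this

/-- measurability of the inner integral -/
lemma meask (h : GoodG b K G G') (r t : ℝ) :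
    AEStronglyMeasurable (fun s => ∫ l in ((s - t) - r)..((s - t) + r), G l s) := by
  have : (fun s => ∫ l in ((s - t) - r)..((s - t) + r), G l s)
      = fun s => ∫ x in (-r)..r, G (x + (s - t)) s := by
    ext s
    rw [intervalIntegral.integral_comp_add_right (fun x => G x s)]
    congr 1 <;> ring
  rw [this]
  have hm : StronglyMeasurable (Function.uncurry (fun s x : ℝ => G (x + (s - t)) s)) := by
    apply Measurable.stronglyMeasurable
    exact h.meas.comp (f := fun z : ℝ × ℝ => (z.2 + (z.1 - t), z.1)) (by fun_prop)
  simp only [intervalIntegral]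
  exact (hm.integral_prod_right.sub hm.integral_prod_right).aestronglyMeasurable

lemma ii (h : GoodG b K G G') (s x y : ℝ) : IntervalIntegrable (fun l => G l s) volume x y :=
  (h.contl s).intervalIntegrable _ _

lemma intle (h : GoodG b K G G') (s x y : ℝ) :
    |∫ l in x..y, G l s| ≤ K * (1 + |s|) ^ (-b) * |y - x| := by
  simpa using intervalIntegral.norm_integral_le_of_norm_le_const (a := x) (b := y)
    (f := fun l => G l s) (C := K * (1 + |s|) ^ (-b)) (fun l _ => by simpa using h.bd l s)

lemma derk (h : GoodG b K G G') (s x : ℝ) (a c : ℝ → ℝ) (a' c' : ℝ)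
    (ha : HasDerivAt a a' x) (hc : HasDerivAt c c' x) :
    HasDerivAt (fun x => ∫ l in (a x)..(c x), G l s) (G (c x) s * c' - G (a x) s * a') x := by
  have e : (fun x => ∫ l in (a x)..(c x), G l s) =
      fun x => (∫ l in (0:ℝ)..(c x), G l s) - ∫ l in (0:ℝ)..(a x), G l s := by
    ext x
    rw [intervalIntegral.integral_interval_sub_left (h.ii _ _ _) (h.ii _ _ _)]
  rw [e]
  have F : ∀ y, HasDerivAt (fun u => ∫ l in (0:ℝ)..u, G l s) (G y s) y := fun y =>
    intervalIntegral.integral_hasDerivAt_right (h.ii _ _ _)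
      ((h.contl s).stronglyMeasurableAtFilter _ _) (h.contl s).continuousAt
  exact ((F (c x)).comp x hc).sub ((F (a x)).comp x ha)

lemma k_eq (h : GoodG b K G G') (s x y : ℝ) (hxy : x = - y) : ∫ l in x..y, G l s = 0 := by
  subst hxy
  have := intervalIntegral.integral_comp_neg (fun l => G l s) (a := -y) (b := y)
  simp only [h.odd, intervalIntegral.integral_neg, neg_neg] at this
  linarith

lemma lipk (h : GoodG b K G G') (s x y x' y' : ℝ) :
    |(∫ l in x..y, G l s) - ∫ l in x'..y', G l s| ≤
      K * (1 + |s|) ^ (-b) * (|x - x'| + |y - y'|) := by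
  have e : (∫ l in x..y, G l s) - ∫ l in x'..y', G l s =
     (∫ l in x..x', G l s) - ∫ l in y..y', G l s := by
    have e1 := intervalIntegral.integral_add_adjacent_intervals (h.ii s x y) (h.ii s y y')
    have e2 := intervalIntegral.integral_add_adjacent_intervals (h.ii s x x') (h.ii s x' y')
    linarith
  rw [e]
  refine (abs_sub _ _).trans ?_
  rw [mul_add, abs_sub_comm x, abs_sub_comm y]
  exact add_le_add (h.intle s x x') (h.intle s y y')

lemma intk (h : GoodG b K G G') (r t : ℝ) :
    Integrable (fun s => ∫ l in ((s - t) - r)..((s - t) + r), G l s) := by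
  refine (h.ibd.mul_const |2 * r|).mono' (h.meask r t) (Eventually.of_forall fun s => ?_)
  have := h.intle s ((s - t) - r) ((s - t) + r)
  rw [Real.norm_eq_abs]
  convert this using 3
  ring

lemma V_dr (h : GoodG b K G G') (r t : ℝ) :
    HasDerivAt (fun r => Vint G r t) (Pint G r t + Pint G (-r) t) r := by
  have := hasDerivAt_integral_param
    (m := fun s r => ∫ l in ((s - t) - r)..((s - t) + r), G l s)
    (m' := fun s => G (s - t + r) s + G (s - t + -r) s)
    (bd := fun s => K * (1 + |s|) ^ (-b) * 2) (t0 := r) (S := Set.Ioi t)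
    (h.ibd.mul_const 2) (fun r => h.meask r t) (h.intk r t) ?_ ?_
  · unfold Pint
    rw [← integral_add]
    · exact this
    · exact (h.intG _ (by fun_prop)).integrableOn
    · exact (h.intG _ (by fun_prop)).integrableOn
  · intro s r'
    refine (h.lipk _ _ _ _ _).trans (le_of_eq ?_)
    have e1 : s - t - r' - (s - t - r) = -(r' - r) := by ring
    have e2 : s - t + r' - (s - t + r) = r' - r := by ring
    rw [e1, e2, abs_neg]; ring
  · refine Eventually.of_forall fun s => ?_
    have := h.derk s r (fun r => (s - t) - r) (fun r => (s - t) + r) (-1) 1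
      (by simpa using (hasDerivAt_id r).const_sub (s - t)) (by simpa using (hasDerivAt_id r).const_add (s - t))
    convert this using 1
    rw [← sub_eq_add_neg]; ring

lemma V_dt (h : GoodG b K G G') (r t : ℝ) :
    HasDerivAt (fun t => Vint G r t) (Pint G (-r) t - Pint G r t) t := by
  have := hasDerivAt_integral_Ioi_param
    (m := fun s t => ∫ l in ((s - t) - r)..((s - t) + r), G l s)
    (m' := fun s => G (s - t + -r) s - G (s - t + r) s)
    (bd := fun s => K * (1 + |s|) ^ (-b) * 2) (t0 := t)
    (h.ibd.mul_const 2) (fun t => h.meask r t) (h.intk r t) ?_ ?_ ?_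
  · unfold Pint
    rw [← integral_sub]
    · refine HasDerivAt.congr_deriv this ?_
      rw [h.k_eq t _ _ (by ring)]; simp
    · exact (h.intG _ (by fun_prop)).integrableOn
    · exact (h.intG _ (by fun_prop)).integrableOn
  · intro s t'
    refine (h.lipk _ _ _ _ _).trans (le_of_eq ?_)
    have e1 : s - t' - r - (s - t - r) = -(t' - t) := by ring
    have e2 : s - t' + r - (s - t + r) = -(t' - t) := by ring
    rw [e1, e2, abs_neg]; ring
  · intro s
    have := h.derk s t (fun t => (s - t) - r) (fun t => (s - t) + r) (-1) (-1)
      (by simpa using ((hasDerivAt_id t).const_sub s).sub_const r)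
      (by simpa using ((hasDerivAt_id t).const_sub s).add_const r)
    convert this using 1
    rw [← sub_eq_add_neg]; ring
  · have e0 : (∫ l in ((t - t) - r)..((t - t) + r), G l t) = 0 := h.k_eq t _ _ (by ring)
    unfold ContinuousAt
    beta_reduce
    rw [e0]
    have hK : ∀ s : ℝ, K * (1 + |s|) ^ (-b) ≤ |K| := by
      intro s
      have : (1 + |s|) ^ (-b) ≤ 1 := Real.rpow_le_one_of_one_le_of_nonpos
        (by linarith [abs_nonneg s]) (by linarith [h.b1])
      have h0 : 0 ≤ (1 + |s|) ^ (-b) := by positivity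
      calc K * (1 + |s|) ^ (-b) ≤ |K| * (1 + |s|) ^ (-b) := by gcongr; exact le_abs_self K
        _ ≤ |K| * 1 := by gcongr
        _ = |K| := mul_one _
    refine squeeze_zero_norm (a := fun s => |K| * (|s - t| + |s - t|)) (fun s => ?_) ?_
    · have := h.lipk s ((s - t) - r) ((s - t) + r) (-r) r
      rw [h.k_eq s (-r) r rfl, sub_zero] at this
      have e1 : s - t - r - -r = s - t := by ring
      have e2 : s - t + r - r = s - t := by ring
      rw [e1, e2] at this
      rw [Real.norm_eq_abs]
      refine this.trans ?_
      gcongr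
      exact hK s
    · have : Continuous (fun s => |K| * (|s - t| + |s - t|)) := by fun_prop
      simpa using this.tendsto t

lemma P_dr (h : GoodG b K G G') (r t : ℝ) :
    HasDerivAt (fun r => Pint G r t) (Pint G' r t) r := by
  refine hasDerivAt_integral_param
    (m := fun s r => G (s - t + r) s) (m' := fun s => G' (s - t + r) s)
    (bd := fun s => K * (1 + |s|) ^ (-b)) (t0 := r) (S := Set.Ioi t)
    (h.ibd) (fun r => h.measG _ (by fun_prop)) (h.intG _ (by fun_prop)) ?_ ?_
  · intro s r'
    refine (h.lipG _ _ _).trans (le_of_eq ?_)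
    congr 2; ring
  · refine Eventually.of_forall fun s => ?_
    have := (h.der (s - t + r) s).comp r ((hasDerivAt_id r).const_add (s - t))
    exact HasDerivAt.congr_deriv this (by simp)

lemma P_dt (h : GoodG b K G G') (r t : ℝ) (ht : 0 < t) :
    HasDerivAt (fun t => Pint G r t) (- G r t - Pint G' r t) t := by
  have := hasDerivAt_integral_Ioi_param
    (m := fun s t => G (s - t + r) s) (m' := fun s => - G' (s - t + r) s)
    (bd := fun s => K * (1 + |s|) ^ (-b)) (t0 := t)
    (h.ibd) (fun r => h.measG _ (by fun_prop)) (h.intG _ (by fun_prop)) ?_ ?_ (h.cont r t ht)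
  · unfold Pint
    refine HasDerivAt.congr_deriv this ?_
    rw [integral_neg]; simp; ring
  · intro s t'
    refine (h.lipG _ _ _).trans (le_of_eq ?_)
    have : s - t' + r - (s - t + r) = -(t' - t) := by ring
    rw [this, abs_neg]
  · intro s
    have := (h.der (s - t + r) s).comp t (((hasDerivAt_id t).const_sub s).add_const r)
    exact HasDerivAt.congr_deriv this (by simp)

end GoodG

def gw (b l s : ℝ) : ℝ := (1 + |l| + s) ^ (-b) * ((1 + |s - abs l|) ^ (-2 : ℝ) + (1 + |l| + s)⁻¹)
def wt (b r t : ℝ) : ℝ := (1 + r + t) ^ (1 - b) * (1 + |r - t|)⁻¹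
def J2 : ℝ := ∫ x : ℝ, (1 + |x|) ^ (-2 : ℝ)

lemma J2_int : Integrable (fun x : ℝ => (1 + |x|) ^ (-2 : ℝ)) := by
  have := integrable_one_add_norm (E := ℝ) (μ := volume) (r := 2) (by simp)
  simpa [Real.norm_eq_abs] using this

lemma J2_nonneg : 0 ≤ J2 := integral_nonneg fun x => by positivity

lemma J2_cont : Continuous (fun x : ℝ => (1 + |x|) ^ (-2 : ℝ)) := by
  apply Continuous.rpow_const (by fun_prop)
  intro x; left; positivity

lemma rpow_tail (b c t : ℝ) (hb : 1 < b) (hc : 0 < c + t) :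
    IntegrableOn (fun s => (c + s) ^ (-b)) (Set.Ioi t) ∧
    ∫ s in Set.Ioi t, (c + s) ^ (-b) = (c + t) ^ (1 - b) / (b - 1) := by
  have hd : ∀ x ∈ Set.Ici t, HasDerivAt (fun s => - (c + s) ^ (1 - b) / (b - 1)) ((c + x) ^ (-b)) x := by
    intro x hx
    have hx' : 0 < c + x := by simp only [Set.mem_Ici] at hx; linarith
    have h1 : HasDerivAt (fun s => c + s) 1 x := by simpa using (hasDerivAt_id x).const_add c
    have h2 := ((h1.rpow_const (p := 1 - b) (Or.inl hx'.ne')).neg).div_const (b - 1)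
    refine HasDerivAt.congr_deriv h2 ?_
    have : b - 1 ≠ 0 := by linarith
    rw [show 1 - b - 1 = -b by ring]
    field_simp
    ring
  have hpos : ∀ x ∈ Set.Ioi t, 0 ≤ (c + x) ^ (-b) := by
    intro x hx
    have hx' : 0 < c + x := by simp only [Set.mem_Ioi] at hx; linarith
    positivity
  have hl : Tendsto (fun s => - (c + s) ^ (1 - b) / (b - 1)) atTop (𝓝 0) := by
    have h1 : Tendsto (fun s : ℝ => (c + s) ^ (-(b - 1))) atTop (𝓝 0) :=
      (tendsto_rpow_neg_atTop (by linarith)).comp (tendsto_atTop_add_const_left _ _ tendsto_id)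
    have := (h1.neg).div_const (b - 1)
    simpa using this
  refine ⟨integrableOn_Ioi_deriv_of_nonneg' hd hpos hl, ?_⟩
  rw [integral_Ioi_of_hasDerivAt_of_nonneg' hd hpos hl]
  ring

lemma rpow_anti {x y a : ℝ} (hx : 0 < x) (hxy : x ≤ y) (ha : a ≤ 0) : y ^ a ≤ x ^ a :=
  Real.rpow_le_rpow_of_nonpos hx hxy ha

lemma half_rpow {X Y b : ℝ} (hb : 0 ≤ b) (hX : 0 < X) (h : X / 2 ≤ Y) : Y ^ (-b) ≤ 2 ^ b * X ^ (-b) := by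
  have h1 : Y ^ (-b) ≤ (X / 2) ^ (-b) := rpow_anti (by positivity) h (by linarith)
  refine h1.trans (le_of_eq ?_)
  rw [Real.div_rpow hX.le (by norm_num), Real.rpow_neg (by norm_num : (0:ℝ) ≤ 2) b]
  field_simp

lemma sq_le_inv {x y : ℝ} (hy : 1 ≤ y) (h : y ≤ x) : x ^ (-2 : ℝ) ≤ y⁻¹ := by
  have h1 : x ^ (-2 : ℝ) ≤ y ^ (-2 : ℝ) := rpow_anti (by linarith) h (by norm_num)
  refine h1.trans ?_
  rw [← Real.rpow_neg_one]
  exact Real.rpow_le_rpow_of_exponent_le hy (by norm_num)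

lemma abs_sub_le_add {r t : ℝ} (hr : 0 ≤ r) (ht : 0 ≤ t) : |r - t| ≤ r + t := by
  rw [abs_le]; constructor <;> linarith

lemma gw_le (b l s r t : ℝ) (hb : 1 < b) (hr : 0 ≤ r) (ht : 0 ≤ t) (hs : 0 ≤ s) (h1 : r + t ≤ |l| + s) :
    gw b l s ≤ 2 ^ b * ((1 + r + t + s) ^ (-b) * ((1 + |s - abs l|) ^ (-2 : ℝ) + (1 + |r - t|)⁻¹)) := by
  unfold gw
  have hl := abs_nonneg l
  have e1 : (1 + |l| + s) ^ (-b) ≤ 2 ^ b * (1 + r + t + s) ^ (-b) :=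
    half_rpow (by linarith) (by linarith) (by linarith)
  have e2 : (1 + |l| + s)⁻¹ ≤ (1 + |r - t|)⁻¹ := by
    apply inv_anti₀ (by positivity)
    linarith [abs_sub_le_add hr ht]
  rw [← mul_assoc]
  have : 0 ≤ (1 + |l| + s)⁻¹ := by positivity
  gcongr

lemma wt_ge (b r t : ℝ) (hr : 0 ≤ r) (ht : 0 ≤ t) : (1 + r + t) ^ (-b) ≤ wt b r t := by
  unfold wt
  have e : (1 + r + t) ^ (-b) = (1 + r + t) ^ (1 - b) * (1 + r + t)⁻¹ := by
    rw [← Real.rpow_neg_one, ← Real.rpow_add (by linarith)]; congr 1; ring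
  rw [e]
  have : 1 + |r - t| ≤ 1 + r + t := by linarith [abs_sub_le_add hr ht]
  gcongr

lemma wt_nonneg (b r t : ℝ) (hr : 0 ≤ r) (ht : 0 ≤ t) : 0 ≤ wt b r t := by
  unfold wt; positivity

lemma gw_le_wt (b r t : ℝ) (hr : 0 ≤ r) (ht : 0 ≤ t) : gw b r t ≤ 2 * wt b r t := by
  refine le_trans ?_ (mul_le_mul_of_nonneg_left (wt_ge b r t hr ht) (by norm_num))
  unfold gw
  rw [abs_of_nonneg hr, mul_comm 2]
  have h0 : 0 ≤ (1 + r + t) ^ (-b) := by positivity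
  have e1 : (1 + |t - r|) ^ (-2 : ℝ) ≤ 1 :=
    Real.rpow_le_one_of_one_le_of_nonpos (by linarith [abs_nonneg (t - r)]) (by norm_num)
  have e2 : (1 + r + t)⁻¹ ≤ 1 := inv_le_one_of_one_le₀ (by linarith)
  gcongr; linarith

lemma gw_le_crude (b l s : ℝ) (hb : 1 < b) (hs : 0 ≤ s) : gw b l s ≤ 2 * (1 + s) ^ (-b) := by
  unfold gw
  have hl := abs_nonneg l
  have h0 : 0 ≤ (1 + |l| + s) ^ (-b) := by positivity
  have e1 : (1 + |s - abs l|) ^ (-2 : ℝ) ≤ 1 :=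
    Real.rpow_le_one_of_one_le_of_nonpos (by linarith [abs_nonneg (s - |l|)]) (by norm_num)
  have e2 : (1 + |l| + s)⁻¹ ≤ 1 := inv_le_one_of_one_le₀ (by linarith)
  have e3 : (1 + |l| + s) ^ (-b) ≤ (1 + s) ^ (-b) := rpow_anti (by linarith) (by linarith) (by linarith)
  calc _ ≤ (1 + |l| + s) ^ (-b) * (1 + 1) := by gcongr
    _ ≤ (1 + s) ^ (-b) * (1 + 1) := by gcongr
    _ = _ := by ring

lemma tail_le (b r t : ℝ) (hb : 1 < b) (hr : 0 ≤ r) (ht : 0 ≤ t) :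
    IntegrableOn (fun s => (1 + r + t + s) ^ (-b)) (Set.Ioi t) ∧
    ∫ s in Set.Ioi t, (1 + r + t + s) ^ (-b) ≤ (1 + r + t) ^ (1 - b) / (b - 1) := by
  have h := rpow_tail b (1 + r + t) t hb (by linarith)
  refine ⟨h.1, ?_⟩
  rw [h.2]
  have : 0 < b - 1 := by linarith
  gcongr ?_ / _
  exact rpow_anti (by linarith) (by linarith) (by linarith)

def C0 (b : ℝ) : ℝ := 2 ^ b * ((5 + 2 * J2) * (2 / (b - 1)) + J2)

lemma C0_pos (b : ℝ) (hb : 1 < b) : 0 < C0 b := by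
  unfold C0
  have := J2_nonneg
  have : 0 < b - 1 := by linarith
  positivity

lemma P_est (b M : ℝ) (hb : 1 < b) (hM : 0 ≤ M) (G : ℝ → ℝ → ℝ)
    (hG : ∀ l s, 0 < s → |G l s| ≤ M * gw b l s) (ρ t : ℝ) (ht : 0 ≤ t) :
    |Pint G ρ t| ≤ C0 b * M * wt b |ρ| t := by
  set r := |ρ| with hr_def
  have hr : 0 ≤ r := abs_nonneg ρ
  have hb1 : 0 < b - 1 := by linarith
  set bd : ℝ → ℝ := fun s => M * 2 ^ b * (((1 + r + t + s) ^ (-b)) * (2 * (1 + |r - t|)⁻¹) +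
    (1 + r + t) ^ (-b) * (1 + |2 * s - (t + r)|) ^ (-2 : ℝ)) with hbd
  have hT := tail_le b r t hb hr ht
  have hJ : Integrable (fun s : ℝ => (1 + |2 * s - (t + r)|) ^ (-2 : ℝ)) :=
    (J2_int.comp_sub_right (t + r)).comp_mul_left' (R := 2) (by norm_num)
  have hJv : ∫ s in Set.Ioi t, (1 + |2 * s - (t + r)|) ^ (-2 : ℝ) ≤ J2 := by
    refine (setIntegral_le_integral hJ (Eventually.of_forall fun s => by positivity)).trans ?_
    have e1 := Measure.integral_comp_mul_left (fun x : ℝ => (1 + |x - (t + r)|) ^ (-2 : ℝ)) 2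
    rw [e1, integral_sub_right_eq_self (fun x : ℝ => (1 + |x|) ^ (-2 : ℝ))]
    have := J2_nonneg
    simp only [smul_eq_mul]
    rw [abs_of_pos (by norm_num)]
    change 2⁻¹ * J2 ≤ J2
    linarith
  have hpt : ∀ s ∈ Set.Ioi t, ‖G (s - t + ρ) s‖ ≤ bd s := by
    intro s hs
    simp only [Set.mem_Ioi] at hs
    have hs0 : 0 < s := by linarith
    rw [Real.norm_eq_abs]
    refine (hG _ s hs0).trans ?_
    simp only [hbd]
    rw [mul_assoc]
    refine mul_le_mul_of_nonneg_left ?_ hM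
    set l := s - t + ρ with hl
    have h1 : r + t ≤ |l| + s := by
      rcases le_total 0 ρ with h | h
      · rw [hr_def, abs_of_nonneg h]; linarith [le_abs_self l]
      · rw [hr_def, abs_of_nonpos h]; linarith [neg_abs_le l]
    refine (gw_le b l s r t hb hr ht hs0.le h1).trans ?_
    refine mul_le_mul_of_nonneg_left ?_ (by positivity)
    have p0 : 0 ≤ (1 + r + t + s) ^ (-b) := by positivity
    have p1 : 0 ≤ (1 + r + t) ^ (-b) * (1 + |2 * s - (t + r)|) ^ (-2 : ℝ) := by positivity
    have q1 : (1 + r + t + s) ^ (-b) ≤ (1 + r + t) ^ (-b) := rpow_anti (by linarith) (by linarith) (by linarith)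
    have p2 : 0 ≤ (1 + |r - t|)⁻¹ := by positivity
    have case1 : 1 + |r - t| ≤ 1 + |s - abs l| →
        (1 + r + t + s) ^ (-b) * ((1 + |s - abs l|) ^ (-2 : ℝ) + (1 + |r - t|)⁻¹) ≤
        (1 + r + t + s) ^ (-b) * (2 * (1 + |r - t|)⁻¹) +
        (1 + r + t) ^ (-b) * (1 + |2 * s - (t + r)|) ^ (-2 : ℝ) := by
      intro h
      have := sq_le_inv (by linarith [abs_nonneg (r - t)]) h
      have : (1 + r + t + s) ^ (-b) * ((1 + |s - abs l|) ^ (-2 : ℝ) + (1 + |r - t|)⁻¹) ≤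
        (1 + r + t + s) ^ (-b) * (2 * (1 + |r - t|)⁻¹) := by gcongr; linarith
      linarith
    rcases le_total 0 ρ with h | h
    · apply case1
      have : r = ρ := by rw [hr_def, abs_of_nonneg h]
      rw [abs_of_nonneg (show 0 ≤ l by linarith)]
      rw [show s - l = -(r - t) by rw [this, hl]; ring, abs_neg]
    · have e : r = -ρ := by rw [hr_def, abs_of_nonpos h]
      rcases le_total (t + r) s with h2 | h2
      · apply case1
        rw [abs_of_nonneg (show 0 ≤ l by linarith)]
        rw [show s - l = r + t by rw [e, hl]; ring, abs_of_nonneg (by linarith : 0 ≤ r + t)]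
        linarith [abs_sub_le_add hr ht]
      · rw [abs_of_nonpos (show l ≤ 0 by linarith)]
        rw [show s - -l = 2 * s - (t + r) by rw [e, hl]; ring]
        have : (1 + r + t + s) ^ (-b) * (1 + |2 * s - (t + r)|) ^ (-2 : ℝ) ≤
          (1 + r + t) ^ (-b) * (1 + |2 * s - (t + r)|) ^ (-2 : ℝ) := by gcongr
        have : 0 ≤ (1 + r + t + s) ^ (-b) * (1 + |r - t|)⁻¹ := by positivity
        linarith
  have hbi : IntegrableOn bd (Set.Ioi t) :=
    ((hT.1.mul_const _).add (hJ.integrableOn.const_mul _)).const_mul _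
  have h3 := norm_integral_le_of_norm_le (μ := volume.restrict (Set.Ioi t)) hbi
    ((ae_restrict_iff' measurableSet_Ioi).2 (Eventually.of_forall hpt))
  rw [Real.norm_eq_abs] at h3
  refine h3.trans ?_
  rw [hbd, integral_const_mul, integral_add (hT.1.mul_const _) (hJ.integrableOn.const_mul _),
    integral_mul_const, integral_const_mul]
  have w0 := wt_ge b r t hr ht
  have wn := wt_nonneg b r t hr ht
  have jn := J2_nonneg
  calc _ ≤ M * 2 ^ b * ((1 + r + t) ^ (1 - b) / (b - 1) * (2 * (1 + |r - t|)⁻¹) + (1 + r + t) ^ (-b) * J2) := by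
        gcongr; exact hT.2
    _ ≤ M * 2 ^ b * ((1 + r + t) ^ (1 - b) / (b - 1) * (2 * (1 + |r - t|)⁻¹) + wt b r t * J2) := by gcongr
    _ = M * 2 ^ b * (1 * (2 / (b - 1)) + J2) * wt b r t := by unfold wt; field_simp
    _ ≤ M * 2 ^ b * ((5 + 2 * J2) * (2 / (b - 1)) + J2) * wt b r t := by gcongr; linarith
    _ = _ := by unfold C0; ring

lemma J_le (r t : ℝ) (hr : 0 < r) (ht : 0 ≤ t) :
    ∫ x in (t - r)..(t + r), (1 + |x|) ^ (-2 : ℝ) ≤ (4 + 2 * J2) * r * (1 + |r - t|)⁻¹ := by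
  have jn := J2_nonneg
  have hpos : 0 < 1 + |r - t| := by positivity
  have hA : ∀ c : ℝ, (∀ x ∈ Set.Icc (t - r) (t + r), (1 + |x|) ^ (-2 : ℝ) ≤ c) →
      ∫ x in (t - r)..(t + r), (1 + |x|) ^ (-2 : ℝ) ≤ 2 * r * c := by
    intro c hc
    have := intervalIntegral.integral_mono_on (a := t - r) (b := t + r) (by linarith)
      (J2_cont.intervalIntegrable _ _) ((continuous_const (y := c)).intervalIntegrable (μ := volume) _ _) hc
    refine this.trans (le_of_eq ?_)
    rw [intervalIntegral.integral_const, smul_eq_mul]; ring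
  have hB : ∫ x in (t - r)..(t + r), (1 + |x|) ^ (-2 : ℝ) ≤ J2 := by
    rw [intervalIntegral.integral_of_le (by linarith)]
    exact setIntegral_le_integral J2_int (Eventually.of_forall fun s => by positivity)
  rw [← div_eq_mul_inv, le_div_iff₀ hpos]
  rcases le_total (2 * r) t with h | h
  · have h1 := hA ((1 + |r - t|)⁻¹) (by
      intro x hx
      apply sq_le_inv (by linarith [abs_nonneg (r - t)])
      rw [abs_of_nonpos (by linarith : r - t ≤ 0)]
      linarith [hx.1, le_abs_self x])
    calc _ ≤ 2 * r * (1 + |r - t|)⁻¹ * (1 + |r - t|) := by gcongr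
      _ = 2 * r := by field_simp
      _ ≤ _ := by nlinarith
  · have h2 : |r - t| ≤ r := by rw [abs_le]; constructor <;> linarith
    rcases le_total r 1 with h3 | h3
    · have h1 := hA 1 (by
        intro x hx
        exact Real.rpow_le_one_of_one_le_of_nonpos (by linarith [abs_nonneg x]) (by norm_num))
      calc _ ≤ 2 * r * 1 * 2 := by gcongr; linarith
        _ ≤ _ := by nlinarith
    · calc _ ≤ J2 * (2 * r) := by gcongr; linarith
        _ ≤ _ := by nlinarith

lemma V_est (b M : ℝ) (hb : 1 < b) (hM : 0 ≤ M) {K : ℝ} {G G' : ℝ → ℝ → ℝ} (h : GoodG b K G G')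
    (hG : ∀ l s, 0 < s → |G l s| ≤ M * gw b l s) (r t : ℝ) (hr : 0 < r) (ht : 0 ≤ t) :
    |Vint G r t| ≤ C0 b * M * r * wt b r t := by
  have hb1 : 0 < b - 1 := by linarith
  have jn := J2_nonneg
  set A := M * 2 ^ b * ((6 + 2 * J2) * r * (1 + |r - t|)⁻¹) with hA
  have hT := tail_le b r t hb hr.le ht
  have hpt : ∀ s ∈ Set.Ioi t, ‖∫ l in ((s - t) - r)..((s - t) + r), G l s‖ ≤ A * (1 + r + t + s) ^ (-b) := by
    intro s hs
    simp only [Set.mem_Ioi] at hs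
    have hs0 : 0 < s := by linarith
    have e : ∫ l in ((s - t) - r)..((s - t) + r), G l s = ∫ l in |(s - t) - r|..((s - t) + r), G l s := by
      rcases le_total r (s - t) with h1 | h1
      · rw [abs_of_nonneg (by linarith)]
      · rw [abs_of_nonpos (by linarith)]
        rw [← intervalIntegral.integral_add_adjacent_intervals (h.ii s (s - t - r) (-(s - t - r))) (h.ii s _ _)]
        rw [h.k_eq s (s - t - r) (-(s - t - r)) (by ring), zero_add]
    rw [e]
    have hle : |(s - t) - r| ≤ (s - t) + r := by rw [abs_le]; constructor <;> linarith
    set f : ℝ → ℝ := fun l => M * 2 ^ b * (1 + r + t + s) ^ (-b) * ((1 + |s - l|) ^ (-2 : ℝ) + (1 + |r - t|)⁻¹) with hf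
    have hfc : Continuous f := by
      have : Continuous fun l => (1 + |s - l|) ^ (-2 : ℝ) := J2_cont.comp (by fun_prop : Continuous fun l => s - l)
      rw [hf]; fun_prop
    have hf0 : ∀ l, 0 ≤ f l := fun l => by rw [hf]; positivity
    have h1 := intervalIntegral.norm_integral_le_of_norm_le (f := fun l => G l s) (g := f) hle
      (ae_of_all volume fun l (hl : l ∈ Set.Ioc |(s - t) - r| ((s - t) + r)) => by
        have hl0 : 0 < l := lt_of_le_of_lt (abs_nonneg _) hl.1
        have hl2 : r + t ≤ |l| + s := by
          rw [abs_of_pos hl0]; linarith [neg_abs_le (s - t - r), hl.1]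
        rw [Real.norm_eq_abs]
        refine (hG l s hs0).trans ?_
        have := mul_le_mul_of_nonneg_left (gw_le b l s r t hb hr.le ht hs0.le hl2) hM
        refine this.trans (le_of_eq ?_)
        rw [abs_of_pos hl0, hf]; ring)
      (hfc.intervalIntegrable _ _)
    refine h1.trans ?_
    have h2 := intervalIntegral.integral_mono_interval (f := f) (μ := volume)
      (c := (s - t) - r) (d := (s - t) + r) (a := |(s - t) - r|) (b := (s - t) + r)
      (le_abs_self _) hle le_rfl (Eventually.of_forall hf0) (hfc.intervalIntegrable _ _)
    refine h2.trans ?_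
    have c1 : Continuous fun l => (1 + |s - l|) ^ (-2 : ℝ) := J2_cont.comp (by fun_prop : Continuous fun l => s - l)
    rw [hf, intervalIntegral.integral_const_mul, intervalIntegral.integral_add
      (c1.intervalIntegrable _ _) (continuous_const.intervalIntegrable _ _),
      intervalIntegral.integral_const,
      intervalIntegral.integral_comp_sub_left (fun x => (1 + |x|) ^ (-2 : ℝ))]
    have e3 : s - (s - t + r) = t - r := by ring
    have e4 : s - (s - t - r) = t + r := by ring
    rw [e3, e4, smul_eq_mul]
    have := J_le r t hr ht
    calc _ ≤ M * 2 ^ b * (1 + r + t + s) ^ (-b) * ((4 + 2 * J2) * r * (1 + |r - t|)⁻¹ + (s - t + r - (s - t - r)) * (1 + |r - t|)⁻¹) := by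
          gcongr
      _ = _ := by rw [hA]; ring
  have h3 := norm_integral_le_of_norm_le (μ := volume.restrict (Set.Ioi t)) (hT.1.const_mul A)
    ((ae_restrict_iff' measurableSet_Ioi).2 (Eventually.of_forall hpt))
  rw [Real.norm_eq_abs] at h3
  refine h3.trans ?_
  rw [integral_const_mul]
  have wn := wt_nonneg b r t hr.le ht
  calc _ ≤ A * ((1 + r + t) ^ (1 - b) / (b - 1)) := by gcongr; exact hT.2
    _ = M * 2 ^ b * ((6 + 2 * J2) * (1 / (b - 1))) * r * wt b r t := by rw [hA]; unfold wt; field_simp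
    _ ≤ M * 2 ^ b * ((5 + 2 * J2) * (2 / (b - 1)) + J2) * r * wt b r t := by
        gcongr
        have : 0 ≤ 1 / (b - 1) := by positivity
        have e : 2 / (b - 1) = 2 * (1 / (b - 1)) := by ring
        rw [e]
        nlinarith [mul_nonneg jn this]
    _ = _ := by unfold C0; ring

def Ut (G : ℝ → ℝ → ℝ) : ℝ → ℝ → ℝ := fun r t => (1 / (2 * r)) * Vint G r t

lemma wt_comp (b ρ r t : ℝ) (hb : 1 < b) (hρ : 0 ≤ ρ) (h : ρ ≤ r) (hr : r ≤ 1) (ht : 0 ≤ t) :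
    wt b ρ t ≤ 2 ^ b * wt b r t := by
  unfold wt
  have h1 : (1 + ρ + t) ^ (1 - b) ≤ 2 ^ (b - 1) * (1 + r + t) ^ (1 - b) := by
    have := half_rpow (b := b - 1) (X := 1 + r + t) (Y := 1 + ρ + t) (by linarith) (by linarith) (by linarith)
    simpa using this
  have h2 : (1 + |ρ - t|)⁻¹ ≤ 2 * (1 + |r - t|)⁻¹ := by
    rw [← div_eq_mul_inv, inv_le_comm₀ (by positivity) (by positivity), inv_div]
    have : |r - t| ≤ |r - ρ| + |ρ - t| := abs_sub_le _ _ _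
    rw [abs_of_nonneg (by linarith : 0 ≤ r - ρ)] at this
    linarith [abs_nonneg (ρ - t)]
  have e : (2:ℝ) ^ b = 2 ^ (b - 1) * 2 := by
    rw [Real.rpow_sub_one (by norm_num)]; ring
  have p : 0 < 1 + r + t := by linarith
  have p' : 0 < 1 + ρ + t := by linarith
  calc _ ≤ (2 ^ (b - 1) * (1 + r + t) ^ (1 - b)) * (2 * (1 + |r - t|)⁻¹) := by gcongr
    _ = _ := by rw [e]; ring

namespace GoodG
variable {b K : ℝ} {G G' : ℝ → ℝ → ℝ}

lemma inv_d (r : ℝ) (hr : r ≠ 0) : HasDerivAt (fun r : ℝ => 1 / (2 * r)) (-(1 / (2 * r ^ 2))) r := by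
  have h1 : HasDerivAt (fun r : ℝ => 2 * r) 2 r := by simpa using (hasDerivAt_id r).const_mul 2
  have h2 := h1.inv (by simpa using hr)
  simp only [one_div]
  refine h2.congr_deriv ?_
  field_simp

lemma U_dr (h : GoodG b K G G') (r t : ℝ) (hr : r ≠ 0) :
    HasDerivAt (fun r => Ut G r t)
      ((1 / (2 * r)) * (Pint G r t + Pint G (-r) t) - 1 / (2 * r ^ 2) * Vint G r t) r := by
  refine ((inv_d r hr).mul (h.V_dr r t)).congr_deriv ?_
  ring

lemma U_dt (h : GoodG b K G G') (r t : ℝ) :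
    HasDerivAt (fun t => Ut G r t) ((1 / (2 * r)) * (Pint G (-r) t - Pint G r t)) t :=
  (h.V_dt r t).const_mul _

lemma pdt_U (h : GoodG b K G G') (r t : ℝ) :
    pdt (Ut G) r t = (1 / (2 * r)) * (Pint G (-r) t - Pint G r t) := (h.U_dt r t).deriv

lemma pdr_U (h : GoodG b K G G') (r t : ℝ) (hr : r ≠ 0) :
    pdr (Ut G) r t = (1 / (2 * r)) * (Pint G r t + Pint G (-r) t) - 1 / (2 * r ^ 2) * Vint G r t :=
  (h.U_dr r t hr).deriv

lemma P_dr_neg (h : GoodG b K G G') (r t : ℝ) :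
    HasDerivAt (fun r => Pint G (-r) t) (-Pint G' (-r) t) r := by
  have := (h.P_dr (-r) t).comp r (hasDerivAt_neg r)
  exact HasDerivAt.congr_deriv this (by simp)

lemma U_drt (h : GoodG b K G G') (r t : ℝ) (hr : r ≠ 0) :
    HasDerivAt (fun r => pdt (Ut G) r t)
      ((1 / (2 * r)) * (-Pint G' (-r) t - Pint G' r t) - 1 / (2 * r ^ 2) * (Pint G (-r) t - Pint G r t)) r := by
  have e : (fun r => pdt (Ut G) r t) = fun r => (1 / (2 * r)) * (Pint G (-r) t - Pint G r t) := by
    ext r; exact h.pdt_U r t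
  rw [e]
  refine ((inv_d r hr).mul ((h.P_dr_neg r t).sub (h.P_dr r t))).congr_deriv ?_
  simp only [Pi.sub_apply]
  ring

lemma U_drr (h : GoodG b K G G') (r t : ℝ) (hr : r ≠ 0) :
    HasDerivAt (fun r => pdr (Ut G) r t)
      ((1 / (2 * r)) * (Pint G' r t - Pint G' (-r) t) - 1 / (2 * r ^ 2) * (Pint G r t + Pint G (-r) t)
       - (1 / (2 * r ^ 2) * (Pint G r t + Pint G (-r) t) - 1 / r ^ 3 * Vint G r t)) r := by
  have e : (fun r => pdr (Ut G) r t) =ᶠ[𝓝 r] fun r => (1 / (2 * r)) * (Pint G r t + Pint G (-r) t) - 1 / (2 * r ^ 2) * Vint G r t := by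
    filter_upwards [isOpen_ne.mem_nhds hr] with x hx
    exact h.pdr_U x t hx
  refine HasDerivAt.congr_of_eventuallyEq ?_ e
  have i2 : HasDerivAt (fun r : ℝ => 1 / (2 * r ^ 2)) (-(1 / r ^ 3)) r := by
    have h1 : HasDerivAt (fun r : ℝ => 2 * r ^ 2) (2 * (2 * r)) r := by
      simpa using (hasDerivAt_pow 2 r).const_mul 2
    have h2 := h1.inv (by simpa using hr)
    simp only [one_div]
    refine h2.congr_deriv ?_
    field_simp
  refine (((inv_d r hr).mul ((h.P_dr r t).add (h.P_dr_neg r t))).sub (i2.mul (h.V_dr r t))).congr_deriv ?_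
  simp only [Pi.add_apply]
  ring

lemma U_dtt (h : GoodG b K G G') (r t : ℝ) (ht : 0 < t) :
    HasDerivAt (fun t => pdt (Ut G) r t)
      ((1 / (2 * r)) * (2 * G r t + Pint G' r t - Pint G' (-r) t)) t := by
  have e : (fun t => pdt (Ut G) r t) = fun t => (1 / (2 * r)) * (Pint G (-r) t - Pint G r t) := by
    ext t; exact h.pdt_U r t
  rw [e]
  refine (((h.P_dt (-r) t ht).sub (h.P_dt r t ht)).const_mul (1 / (2 * r))).congr_deriv ?_
  rw [h.odd]; ring

lemma U_abs (h : GoodG b K G G') {M : ℝ} (hM : 0 ≤ M)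
    (hG : ∀ l s, 0 < s → |G l s| ≤ M * gw b l s) (r t : ℝ) (hr : 0 < r) (ht : 0 ≤ t) :
    |Ut G r t| ≤ C0 b * M * wt b r t := by
  unfold Ut
  have := V_est b M h.b1 hM h hG r t hr ht
  rw [abs_mul, abs_of_pos (by positivity)]
  have wn := wt_nonneg b r t hr.le ht
  have c := C0_pos b h.b1
  calc _ ≤ 1 / (2 * r) * (C0 b * M * r * wt b r t) := by gcongr
    _ = C0 b * M * wt b r t / 2 := by field_simp
    _ ≤ _ := by have : 0 ≤ C0 b * M * wt b r t := by positivity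
                linarith

lemma P_abs (h : GoodG b K G G') {M : ℝ} (hM : 0 ≤ M) {H : ℝ → ℝ → ℝ}
    (hG : ∀ l s, 0 < s → |H l s| ≤ M * gw b l s) (r t : ℝ) (hr : 0 < r) (ht : 0 ≤ t) :
    |Pint H r t| ≤ C0 b * M * wt b r t ∧ |Pint H (-r) t| ≤ C0 b * M * wt b r t := by
  have h1 := P_est b M h.b1 hM H hG r t ht
  have h2 := P_est b M h.b1 hM H hG (-r) t ht
  rw [abs_neg] at h2
  rw [abs_of_pos hr] at h1 h2
  exact ⟨h1, h2⟩

lemma rUt_abs (h : GoodG b K G G') {M : ℝ} (hM : 0 ≤ M)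
    (hG : ∀ l s, 0 < s → |G l s| ≤ M * gw b l s) (r t : ℝ) (hr : 0 < r) (ht : 0 ≤ t) :
    r * |pdt (Ut G) r t| ≤ C0 b * M * wt b r t := by
  obtain ⟨h1, h2⟩ := h.P_abs hM hG r t hr ht
  rw [h.pdt_U, abs_mul, abs_of_pos (by positivity : 0 < 1 / (2 * r)), ← mul_assoc,
    show r * (1 / (2 * r)) = 1 / 2 by field_simp]
  have := abs_sub (Pint G (-r) t) (Pint G r t)
  linarith

lemma rUr_abs (h : GoodG b K G G') {M : ℝ} (hM : 0 ≤ M)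
    (hG : ∀ l s, 0 < s → |G l s| ≤ M * gw b l s) (r t : ℝ) (hr : 0 < r) (ht : 0 ≤ t) :
    r * |pdr (Ut G) r t| ≤ 2 * C0 b * M * wt b r t := by
  obtain ⟨h1, h2⟩ := h.P_abs hM hG r t hr ht
  have h3 := h.U_abs hM hG r t hr ht
  rw [← abs_of_pos hr, ← abs_mul, abs_of_pos hr, h.pdr_U r t hr.ne']
  have e : r * (1 / (2 * r) * (Pint G r t + Pint G (-r) t) - 1 / (2 * r ^ 2) * Vint G r t)
    = (Pint G r t + Pint G (-r) t) / 2 - Ut G r t := by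
    unfold Ut; field_simp
  rw [e]
  have e1 := abs_sub ((Pint G r t + Pint G (-r) t) / 2) (Ut G r t)
  have e2 := abs_add_le (Pint G r t) (Pint G (-r) t)
  rw [abs_div, abs_two] at e1
  linarith

lemma small (h : GoodG b K G G') {M : ℝ} (hM : 0 ≤ M)
    (hG' : ∀ l s, 0 < s → |G' l s| ≤ M * gw b l s) (r t : ℝ) (hr : 0 < r) (hr1 : r ≤ 1) (ht : 0 ≤ t) :
    |pdt (Ut G) r t| ≤ 2 ^ b * C0 b * M * wt b r t ∧ |pdr (Ut G) r t| ≤ 2 ^ b * C0 b * M * wt b r t := by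
  set E := 2 ^ b * C0 b * M * wt b r t with hE
  have c := C0_pos b h.b1
  have hP : ∀ x, |x| ≤ r → |Pint G' x t| ≤ E := by
    intro x hx
    refine (P_est b M h.b1 hM G' hG' x t ht).trans ?_
    have := wt_comp b |x| r t h.b1 (abs_nonneg x) hx hr1 ht
    calc _ ≤ C0 b * M * (2 ^ b * wt b r t) := by gcongr
      _ = E := by rw [hE]; ring
  constructor
  · have := Convex.norm_image_sub_le_of_norm_hasDerivWithin_le (s := Set.Icc (-r) r)
      (f := fun x => Pint G x t) (f' := fun x => Pint G' x t) (x := r) (y := -r) (C := E)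
      (fun x _ => (h.P_dr x t).hasDerivWithinAt) (fun x hx => by simpa using hP x (abs_le.2 hx))
      (convex_Icc _ _) ⟨by linarith, le_rfl⟩ ⟨le_rfl, by linarith⟩
    rw [Real.norm_eq_abs, Real.norm_eq_abs, show -r - r = -(2 * r) by ring, abs_neg,
      abs_of_pos (by linarith : 0 < 2 * r)] at this
    rw [h.pdt_U, abs_mul, abs_of_pos (by positivity)]
    calc _ ≤ 1 / (2 * r) * (E * (2 * r)) := by gcongr
      _ = E := by field_simp
  · have hd : ∀ x, HasDerivAt (fun x => x * (Pint G x t + Pint G (-x) t) - Vint G x t)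
        (x * (Pint G' x t - Pint G' (-x) t)) x := by
      intro x
      refine (((hasDerivAt_id x).mul ((h.P_dr x t).add (h.P_dr_neg x t))).sub (h.V_dr x t)).congr_deriv ?_
      simp only [Pi.add_apply, id]
      ring
    have := Convex.norm_image_sub_le_of_norm_hasDerivWithin_le (s := Set.Icc 0 r)
      (f := fun x => x * (Pint G x t + Pint G (-x) t) - Vint G x t)
      (f' := fun x => x * (Pint G' x t - Pint G' (-x) t)) (x := 0) (y := r) (C := r * (2 * E))
      (fun x _ => (hd x).hasDerivWithinAt) (fun x hx => by
        have a1 := hP x (by rw [abs_of_nonneg hx.1]; exact hx.2)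
        have a2 := hP (-x) (by rw [abs_neg, abs_of_nonneg hx.1]; exact hx.2)
        rw [norm_mul, Real.norm_eq_abs, Real.norm_eq_abs, abs_of_nonneg hx.1]
        have := abs_sub (Pint G' x t) (Pint G' (-x) t)
        have := hx.2
        have := hx.1
        gcongr
        linarith)
      (convex_Icc _ _) ⟨le_rfl, hr.le⟩ ⟨hr.le, le_rfl⟩
    have hV0 : Vint G 0 t = 0 := by simp [Vint]
    simp only [hV0, zero_mul, sub_zero, Real.norm_eq_abs, abs_of_pos hr] at this
    rw [h.pdr_U r t hr.ne']
    have e : 1 / (2 * r) * (Pint G r t + Pint G (-r) t) - 1 / (2 * r ^ 2) * Vint G r t =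
      1 / (2 * r ^ 2) * (r * (Pint G r t + Pint G (-r) t) - Vint G r t) := by field_simp
    rw [e, abs_mul, abs_of_pos (by positivity)]
    calc _ ≤ 1 / (2 * r ^ 2) * (r * (2 * E) * r) := by gcongr
      _ = E := by field_simp

lemma first (h : GoodG b K G G') {M : ℝ} (hM : 0 ≤ M)
    (hG : ∀ l s, 0 < s → |G l s| ≤ M * gw b l s)
    (hG' : ∀ l s, 0 < s → |G' l s| ≤ M * gw b l s) (r t : ℝ) (hr : 0 < r) (ht : 0 ≤ t) :
    (1 + r) * (|pdr (Ut G) r t| + |pdt (Ut G) r t|) ≤ 6 * 2 ^ b * C0 b * M * wt b r t := by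
  have wn := wt_nonneg b r t hr.le ht
  have c := C0_pos b h.b1
  have p0 : 0 ≤ C0 b * M * wt b r t := by positivity
  have two : (1:ℝ) ≤ 2 ^ b := Real.one_le_rpow (by norm_num) (by linarith [h.b1])
  rcases le_total r 1 with h1 | h1
  · obtain ⟨a1, a2⟩ := h.small hM hG' r t hr h1 ht
    have : 0 ≤ 2 ^ b * C0 b * M * wt b r t := by positivity
    calc _ ≤ 2 * (2 ^ b * C0 b * M * wt b r t + 2 ^ b * C0 b * M * wt b r t) := by gcongr; linarith
      _ ≤ _ := by linarith
  · have a1 := h.rUt_abs hM hG r t hr ht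
    have a2 := h.rUr_abs hM hG r t hr ht
    have : (1 + r) * (|pdr (Ut G) r t| + |pdt (Ut G) r t|) ≤ 2 * r * (|pdr (Ut G) r t| + |pdt (Ut G) r t|) := by
      gcongr; linarith
    nlinarith

lemma second (h : GoodG b K G G') {M : ℝ} (hM : 0 ≤ M)
    (hG : ∀ l s, 0 < s → |G l s| ≤ M * gw b l s)
    (hG' : ∀ l s, 0 < s → |G' l s| ≤ M * gw b l s) (r t : ℝ) (hr : 0 < r) (ht : 0 ≤ t) :
    r * |pdr (pdr (Ut G)) r t| ≤ 13 * 2 ^ b * C0 b * M * wt b r t ∧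
    r * |pdr (pdt (Ut G)) r t| ≤ 13 * 2 ^ b * C0 b * M * wt b r t ∧
    (0 < t → r * |pdt (pdt (Ut G)) r t| ≤ (2 + C0 b) * M * wt b r t) := by
  have wn := wt_nonneg b r t hr.le ht
  have c := C0_pos b h.b1
  have p0 : 0 ≤ C0 b * M * wt b r t := by positivity
  have two : (1:ℝ) ≤ 2 ^ b := Real.one_le_rpow (by norm_num) (by linarith [h.b1])
  have p1 : C0 b * M * wt b r t ≤ 2 ^ b * C0 b * M * wt b r t := by nlinarith
  have f1 := h.first hM hG hG' r t hr ht
  have f2 : |pdr (Ut G) r t| + |pdt (Ut G) r t| ≤ 6 * 2 ^ b * C0 b * M * wt b r t := by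
    refine le_trans ?_ f1
    have : 0 ≤ |pdr (Ut G) r t| + |pdt (Ut G) r t| := by positivity
    nlinarith
  have n1 := abs_nonneg (pdr (Ut G) r t)
  have n2 := abs_nonneg (pdt (Ut G) r t)
  obtain ⟨q1, q2⟩ := h.P_abs hM hG' r t hr ht
  refine ⟨?_, ?_, ?_⟩
  · have e0 : pdr (pdr (Ut G)) r t = _ := (h.U_drr r t hr.ne').deriv
    rw [← abs_of_pos hr, ← abs_mul, abs_of_pos hr, e0]
    have e : r * (1 / (2 * r) * (Pint G' r t - Pint G' (-r) t) - 1 / (2 * r ^ 2) * (Pint G r t + Pint G (-r) t)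
       - (1 / (2 * r ^ 2) * (Pint G r t + Pint G (-r) t) - 1 / r ^ 3 * Vint G r t))
      = (Pint G' r t - Pint G' (-r) t) / 2 - 2 * pdr (Ut G) r t := by
      rw [h.pdr_U r t hr.ne']; field_simp; ring
    rw [e]
    have e1 := abs_sub ((Pint G' r t - Pint G' (-r) t) / 2) (2 * pdr (Ut G) r t)
    have e2 := abs_sub (Pint G' r t) (Pint G' (-r) t)
    rw [abs_div, abs_mul, abs_two] at e1
    linarith
  · have e0 : pdr (pdt (Ut G)) r t = _ := (h.U_drt r t hr.ne').deriv
    rw [← abs_of_pos hr, ← abs_mul, abs_of_pos hr, e0]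
    have e : r * (1 / (2 * r) * (-Pint G' (-r) t - Pint G' r t) - 1 / (2 * r ^ 2) * (Pint G (-r) t - Pint G r t))
      = -((Pint G' r t + Pint G' (-r) t) / 2) - pdt (Ut G) r t := by
      rw [h.pdt_U r t]; field_simp; ring
    rw [e]
    have e1 := abs_sub (-((Pint G' r t + Pint G' (-r) t) / 2)) (pdt (Ut G) r t)
    have e2 := abs_add_le (Pint G' r t) (Pint G' (-r) t)
    rw [abs_neg, abs_div, abs_two] at e1
    linarith
  · intro ht'
    have e0 : pdt (pdt (Ut G)) r t = _ := (h.U_dtt r t ht').deriv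
    rw [← abs_of_pos hr, ← abs_mul, abs_of_pos hr, e0]
    have e : r * (1 / (2 * r) * (2 * G r t + Pint G' r t - Pint G' (-r) t))
      = G r t + (Pint G' r t - Pint G' (-r) t) / 2 := by
      field_simp; ring
    rw [e]
    have e1 := abs_add_le (G r t) ((Pint G' r t - Pint G' (-r) t) / 2)
    have e2 := abs_sub (Pint G' r t) (Pint G' (-r) t)
    rw [abs_div, abs_two] at e1
    have e3 := hG r t ht'
    have e4 := mul_le_mul_of_nonneg_left (gw_le_wt b r t hr.le ht) hM
    linarith
end GoodG

/-- a function whose values are those of `T` or `0` has derivative no larger than that of `T`. -/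
lemma deriv_junk (f T : ℝ → ℝ) (r : ℝ) (hT : DifferentiableAt ℝ T r) (hf : ∀ x, f x = T x ∨ f x = 0) :
    |deriv f r| ≤ |deriv T r| := by
  by_cases hd : DifferentiableAt ℝ f r
  swap
  · rw [deriv_zero_of_not_differentiableAt hd, abs_zero]; exact abs_nonneg _
  by_cases h0 : deriv f r = 0
  · rw [h0, abs_zero]; exact abs_nonneg _
  have key : f =ᶠ[𝓝 r] T := by
    by_cases hr : f r = 0
    · have h1 : ∀ᶠ x in 𝓝[≠] r, f x ≠ f r := hd.hasDerivAt.eventually_ne h0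
      have h2 : ∀ᶠ x in 𝓝[≠] r, f x = T x := by
        filter_upwards [h1] with x hx
        rw [hr] at hx
        exact (hf x).resolve_right hx
      have h3 : f r = T r :=
        tendsto_nhds_unique (hd.continuousAt.continuousWithinAt (s := {r}ᶜ))
          ((hT.continuousAt.continuousWithinAt (s := {r}ᶜ)).congr' (h2.mono fun x hx => hx.symm))
      rw [eventually_nhdsWithin_iff] at h2
      filter_upwards [h2] with x hx
      by_cases hxr : x = r
      · rw [hxr, h3]
      · exact hx hxr
    · filter_upwards [hd.continuousAt.eventually_ne hr] with x hx
      exact (hf x).resolve_right hx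
  rw [key.deriv_eq]

/-- right-limit bound for the derivative at `0`. -/
lemma deriv_zero_bound (f B : ℝ → ℝ) (hB : ContinuousWithinAt B (Set.Ioi 0) 0) (hB0 : 0 ≤ B 0)
    (hd : ∀ t, 0 < t → DifferentiableAt ℝ f t) (hb : ∀ t, 0 < t → |deriv f t| ≤ B t) :
    |deriv f 0| ≤ B 0 := by
  by_cases h0 : DifferentiableAt ℝ f 0
  swap
  · rw [deriv_zero_of_not_differentiableAt h0, abs_zero]; exact hB0
  refine le_of_forall_pos_le_add fun η hη => ?_
  have h1 : Tendsto (fun t => |slope f 0 t|) (𝓝[>] 0) (𝓝 |deriv f 0|) :=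
    ((hasDerivAt_iff_tendsto_slope.1 h0.hasDerivAt).mono_left
      (nhdsWithin_mono _ (fun x hx => (ne_of_gt hx : x ≠ 0)))).abs
  refine le_of_tendsto h1 ?_
  have h2 : ∀ᶠ t in 𝓝[>] (0:ℝ), B t < B 0 + η := hB.eventually (gt_mem_nhds (by linarith))
  rw [eventually_nhdsWithin_iff, Metric.eventually_nhds_iff] at h2
  obtain ⟨δ, hδ, h3⟩ := h2
  filter_upwards [Ioo_mem_nhdsGT hδ] with t ht
  obtain ⟨c, hc, hc2⟩ := exists_deriv_eq_slope f ht.1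
    (fun x hx => by
      rcases eq_or_lt_of_le hx.1 with h | h
      · rw [← h]; exact h0.continuousAt.continuousWithinAt
      · exact (hd x h).continuousAt.continuousWithinAt)
    (fun x hx => (hd x hx.1).differentiableWithinAt)
  rw [slope_def_field, ← hc2]
  refine (hb c hc.1).trans (h3 ?_ hc.1).le
  rw [Real.dist_eq, sub_zero, abs_of_pos hc.1]; linarith [hc.2, ht.2]

section transfer
variable {b K : ℝ} {G G' : ℝ → ℝ → ℝ} {R : ℝ → ℝ → ℝ}

lemma tr_pdr (hR : ∀ r t, 0 ≤ t → R r t = Ut G r t) (r t : ℝ) (ht : 0 ≤ t) :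
    pdr R r t = pdr (Ut G) r t := by
  unfold pdr; congr 1; ext x; exact hR x t ht

lemma tr_pdrr (hR : ∀ r t, 0 ≤ t → R r t = Ut G r t) (r t : ℝ) (ht : 0 ≤ t) :
    pdr (pdr R) r t = pdr (pdr (Ut G)) r t := by
  unfold pdr; congr 1; ext x; exact tr_pdr hR x t ht

lemma tr_pdt (hR : ∀ r t, 0 ≤ t → R r t = Ut G r t) (r t : ℝ) (ht : 0 < t) :
    pdt R r t = pdt (Ut G) r t := by
  unfold pdt
  apply EventuallyEq.deriv_eq
  filter_upwards [lt_mem_nhds ht] with x hx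
  exact hR r x hx.le

lemma tr_pdt_or (h : GoodG b K G G') (hR : ∀ r t, 0 ≤ t → R r t = Ut G r t) (r t : ℝ) (ht : 0 ≤ t) :
    pdt R r t = pdt (Ut G) r t ∨ pdt R r t = 0 := by
  rcases eq_or_lt_of_le ht with h0 | h0
  swap
  · exact Or.inl (tr_pdt hR r t h0)
  subst h0
  by_cases hd : DifferentiableAt ℝ (fun t => R r t) 0
  swap
  · right; exact deriv_zero_of_not_differentiableAt hd
  left
  have h1 : HasDerivWithinAt (fun t => R r t) (pdt R r 0) (Set.Ici 0) 0 := hd.hasDerivAt.hasDerivWithinAt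
  have h2 : HasDerivWithinAt (fun t => Ut G r t) (pdt (Ut G) r 0) (Set.Ici 0) 0 :=
    (h.U_dt r 0).differentiableAt.hasDerivAt.hasDerivWithinAt
  have h3 : HasDerivWithinAt (fun t => R r t) (pdt (Ut G) r 0) (Set.Ici 0) 0 :=
    h2.congr (fun x hx => hR r x hx) (hR r 0 le_rfl)
  exact (uniqueDiffOn_Ici (0:ℝ) 0 (by simp)).eq_deriv _ h1 h3

lemma tr_pdt_le (h : GoodG b K G G') (hR : ∀ r t, 0 ≤ t → R r t = Ut G r t) (r t : ℝ) (ht : 0 ≤ t) :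
    |pdt R r t| ≤ |pdt (Ut G) r t| := by
  rcases tr_pdt_or h hR r t ht with e | e
  · rw [e]
  · rw [e, abs_zero]; exact abs_nonneg _

lemma tr_pdrt_le (h : GoodG b K G G') (hR : ∀ r t, 0 ≤ t → R r t = Ut G r t) (r t : ℝ) (hr : 0 < r) (ht : 0 ≤ t) :
    |pdr (pdt R) r t| ≤ |pdr (pdt (Ut G)) r t| :=
  deriv_junk (fun x => pdt R x t) (fun x => pdt (Ut G) x t) r (h.U_drt r t hr.ne').differentiableAt
    (fun x => tr_pdt_or h hR x t ht)

lemma tr_pdtt_le (h : GoodG b K G G') (hR : ∀ r t, 0 ≤ t → R r t = Ut G r t) {M : ℝ} (hM : 0 ≤ M)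
    (hG : ∀ l s, 0 < s → |G l s| ≤ M * gw b l s)
    (hG' : ∀ l s, 0 < s → |G' l s| ≤ M * gw b l s) (r t : ℝ) (hr : 0 < r) (ht : 0 ≤ t) :
    r * |pdt (pdt R) r t| ≤ (2 + C0 b) * M * wt b r t := by
  have c := C0_pos b h.b1
  have ev : ∀ t, 0 < t → (fun t => pdt R r t) =ᶠ[𝓝 t] fun t => pdt (Ut G) r t := by
    intro t ht
    filter_upwards [lt_mem_nhds ht] with x hx
    exact tr_pdt hR r x hx
  have hpos : ∀ t, 0 < t → r * |pdt (pdt R) r t| ≤ (2 + C0 b) * M * wt b r t := by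
    intro t h0
    have e : pdt (pdt R) r t = pdt (pdt (Ut G)) r t := (ev t h0).deriv_eq
    rw [e]
    exact (h.second hM hG hG' r t hr h0.le).2.2 h0
  rcases eq_or_lt_of_le ht with h0 | h0
  swap
  · exact hpos t h0
  subst h0
  have := deriv_zero_bound (fun t => pdt R r t) (fun t => (2 + C0 b) * M * wt b r t / r) ?_ ?_ ?_ ?_
  · have := mul_le_mul_of_nonneg_left this hr.le
    refine this.trans (le_of_eq ?_)
    field_simp
  · have : ContinuousAt (fun t => (2 + C0 b) * M * wt b r t / r) 0 := by
      unfold wt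
      refine ContinuousAt.div_const (ContinuousAt.mul continuousAt_const (ContinuousAt.mul ?_ ?_)) _
      · exact ContinuousAt.rpow_const (by fun_prop) (Or.inl (by linarith))
      · exact ContinuousAt.inv₀ (by fun_prop) (by positivity)
    exact this.continuousWithinAt
  · have := wt_nonneg b r 0 hr.le le_rfl
    positivity
  · intro t h0
    exact (h.U_dtt r t h0).differentiableAt.congr_of_eventuallyEq (ev t h0)
  · intro t h0
    rw [le_div_iff₀ hr, mul_comm]
    exact hpos t h0

lemma br1_le (h : GoodG b K G G') (hR : ∀ r t, 0 ≤ t → R r t = Ut G r t) {M : ℝ} (hM : 0 ≤ M)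
    (hG : ∀ l s, 0 < s → |G l s| ≤ M * gw b l s) (r t : ℝ) (hr : 0 < r) (ht : 0 ≤ t) :
    bracket1 R r t ≤ 4 * C0 b * M * wt b r t := by
  unfold bracket1
  rw [hR r t ht, tr_pdr hR r t ht]
  have a1 := h.U_abs hM hG r t hr ht
  have a2 := h.rUr_abs hM hG r t hr ht
  have a3 := h.rUt_abs hM hG r t hr ht
  have a4 := mul_le_mul_of_nonneg_left (tr_pdt_le h hR r t ht) hr.le
  linarith

def C2 (b : ℝ) : ℝ := C0 b + 6 * 2 ^ b * C0 b + 26 * 2 ^ b * C0 b + (2 + C0 b)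

lemma br2_le (h : GoodG b K G G') (hR : ∀ r t, 0 ≤ t → R r t = Ut G r t) {M : ℝ} (hM : 0 ≤ M)
    (hG : ∀ l s, 0 < s → |G l s| ≤ M * gw b l s)
    (hG' : ∀ l s, 0 < s → |G' l s| ≤ M * gw b l s) (r t : ℝ) (hr : 0 < r) (ht : 0 ≤ t) :
    bracket2 R r t ≤ C2 b * M * wt b r t := by
  unfold bracket2
  rw [hR r t ht, tr_pdr hR r t ht, tr_pdrr hR r t ht]
  have a1 := h.U_abs hM hG r t hr ht
  have a2 := h.first hM hG hG' r t hr ht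
  have a4 := mul_le_mul_of_nonneg_left (tr_pdt_le h hR r t ht) (by linarith : 0 ≤ 1 + r)
  obtain ⟨a5, a6, -⟩ := h.second hM hG hG' r t hr ht
  have a7 := mul_le_mul_of_nonneg_left (tr_pdrt_le h hR r t hr ht) hr.le
  have a8 := tr_pdtt_le h hR hM hG hG' r t hr ht
  unfold C2
  linarith
end transfer

lemma hasDerivAt_id_mul_zero (g : ℝ → ℝ) (hc : ContinuousAt g 0) :
    HasDerivAt (fun x => x * g x) (g 0) 0 := by
  rw [hasDerivAt_iff_tendsto_slope]
  have h1 : Tendsto g (𝓝[≠] 0) (𝓝 (g 0)) := hc.tendsto.mono_left nhdsWithin_le_nhds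
  refine h1.congr' ?_
  filter_upwards [self_mem_nhdsWithin] with x hx
  have hx : x ≠ 0 := hx
  simp [slope_def_field, hx]

lemma hasDerivAt_psi (a : ℝ) (ha : 0 < a) (x : ℝ) :
    HasDerivAt (fun x : ℝ => x * |x| ^ a) ((a + 1) * |x| ^ a) x := by
  by_cases hx : x = 0
  · subst hx
    refine (hasDerivAt_id_mul_zero (fun x : ℝ => |x| ^ a) ?_).congr_deriv ?_
    · exact continuous_abs.continuousAt.rpow_const (Or.inr ha.le)
    · simp [Real.zero_rpow ha.ne']
  · have hp : 0 < |x| := abs_pos.2 hx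
    have h1 := (hasDerivAt_abs hx).rpow_const (p := a) (Or.inl hp.ne')
    refine ((hasDerivAt_id x).mul h1).congr_deriv ?_
    have e : |x| ^ a = |x| ^ (a - 1) * |x| := by
      rw [← Real.rpow_add_one hp.ne']; ring_nf
    have s : x * ((SignType.sign x : SignType) : ℝ) = |x| := by
      rw [mul_comm]; exact sign_mul_self x
    simp only [id]
    rw [e]
    linear_combination (a * |x| ^ (a-1)) * s

lemma abs_rpow_sub_le (q : ℝ) (hq : 1 < q) (x y m : ℝ) (hx : |x| ≤ m) (hy : |y| ≤ m) :
    |(|x| ^ q - |y| ^ q)| ≤ q * m ^ (q - 1) * |x - y| := by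
  have := Convex.norm_image_sub_le_of_norm_hasDerivWithin_le (s := Set.Icc (-m) m)
      (f := fun x : ℝ => |x| ^ q) (f' := fun x => q * |x| ^ (q - 2) * x) (x := y) (y := x)
      (C := q * m ^ (q - 1))
      (fun x _ => (hasDerivAt_abs_rpow x hq).hasDerivWithinAt) (fun x hx => ?_)
      (convex_Icc _ _) (abs_le.1 hy) (abs_le.1 hx)
  · simpa using this
  · have hx := abs_le.2 hx
    rw [Real.norm_eq_abs, abs_mul, abs_mul, abs_of_pos (by linarith : 0 < q), mul_assoc]
    gcongr
    by_cases h0 : x = 0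
    · subst h0
      simp only [abs_zero, mul_zero] at hx ⊢
      positivity
    · have hp : 0 < |x| := abs_pos.2 h0
      rw [abs_of_nonneg (by positivity : 0 ≤ |x| ^ (q - 2)), ← Real.rpow_add_one hp.ne']
      rw [show q - 2 + 1 = q - 1 by ring]
      exact Real.rpow_le_rpow hp.le hx (by linarith)

lemma psi_sub_le (q : ℝ) (hq : 2 < q) (x y m : ℝ) (hx : |x| ≤ m) (hy : |y| ≤ m) :
    |(x * |x| ^ (q - 2) - y * |y| ^ (q - 2))| ≤ (q - 1) * m ^ (q - 2) * |x - y| := by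
  have := Convex.norm_image_sub_le_of_norm_hasDerivWithin_le (s := Set.Icc (-m) m)
      (f := fun x : ℝ => x * |x| ^ (q - 2)) (f' := fun x => (q - 2 + 1) * |x| ^ (q - 2)) (x := y) (y := x)
      (C := (q - 1) * m ^ (q - 2))
      (fun x _ => (hasDerivAt_psi (q - 2) (by linarith) x).hasDerivWithinAt) (fun x hx => ?_)
      (convex_Icc _ _) (abs_le.1 hy) (abs_le.1 hx)
  · simpa using this
  · have hx := abs_le.2 hx
    rw [Real.norm_eq_abs, abs_of_nonneg (by have : 0 ≤ q - 2 + 1 := by linarith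
                                            positivity)]
    rw [show q - 2 + 1 = q - 1 by ring]
    have : 0 ≤ q - 1 := by linarith
    have := Real.rpow_le_rpow (abs_nonneg x) hx (by linarith : 0 ≤ q - 2)
    gcongr

lemma psi_abs (q : ℝ) (hq : 2 < q) (x m : ℝ) (hx : |x| ≤ m) :
    |(x * |x| ^ (q - 2))| ≤ m ^ (q - 1) := by
  have hm : 0 ≤ m := (abs_nonneg x).trans hx
  rw [abs_mul, abs_of_nonneg (by positivity : 0 ≤ |x| ^ (q - 2))]
  by_cases h0 : x = 0
  · subst h0; simp only [abs_zero, zero_mul]; positivity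
  · have hp : 0 < |x| := abs_pos.2 h0
    rw [mul_comm, ← Real.rpow_add_one hp.ne', show q - 2 + 1 = q - 1 by ring]
    exact Real.rpow_le_rpow hp.le hx (by linarith)

/-- the algebraic heart of the pointwise nonlinear estimates -/
lemma point_est (q : ℝ) (hq : 2 < q) (l B δ x y xl yl : ℝ) (hl : 0 < l) (hB : 0 ≤ B)
    (hx : (1 + l) * |x| ≤ B) (hy : (1 + l) * |y| ≤ B) (hyl : l * |yl| ≤ B)
    (hd : (1 + l) * |x - y| ≤ δ) (hdl : l * |xl - yl| ≤ δ) :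
    |l * (q * (x * |x| ^ (q - 2)) * xl - q * (y * |y| ^ (q - 2)) * yl)|
      ≤ q ^ 2 * ((B / (1 + l)) ^ (q - 1) * δ) := by
  set m := B / (1 + l) with hm
  have L : 0 < 1 + l := by linarith
  have hx' : |x| ≤ m := by rw [hm, le_div_iff₀ L]; linarith
  have hy' : |y| ≤ m := by rw [hm, le_div_iff₀ L]; linarith
  have hd' : |x - y| ≤ δ / (1 + l) := by rw [le_div_iff₀ L]; linarith
  have hm0 : 0 ≤ m := (abs_nonneg x).trans hx'
  have hδ : 0 ≤ δ := le_trans (by positivity) hd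
  have e : l * (q * (x * |x| ^ (q - 2)) * xl - q * (y * |y| ^ (q - 2)) * yl)
    = q * ((x * |x| ^ (q - 2)) * (l * (xl - yl)) + (x * |x| ^ (q - 2) - y * |y| ^ (q - 2)) * (l * yl)) := by
    ring
  have a1 := psi_abs q hq x m hx'
  have a2 := psi_sub_le q hq x y m hx' hy'
  have b1 : |l * (xl - yl)| ≤ δ := by rwa [abs_mul, abs_of_pos hl]
  have b2 : |l * yl| ≤ B := by rwa [abs_mul, abs_of_pos hl]
  have q0 : 0 < q := by linarith
  have q1 : 0 ≤ q - 1 := by linarith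
  have c2 : m ^ (q - 2) * (δ / (1 + l)) * B = m ^ (q - 1) * δ := by
    by_cases h0 : B = 0
    · have : m = 0 := by rw [hm, h0, zero_div]
      rw [this, h0, Real.zero_rpow (by linarith : q - 1 ≠ 0)]; ring
    · have hmp : m ≠ 0 := by rw [hm]; positivity
      rw [show q - 1 = q - 2 + 1 by ring, Real.rpow_add_one hmp, hm]
      field_simp
  rw [e, abs_mul, abs_of_pos q0]
  calc _ ≤ q * (|(x * |x| ^ (q - 2))| * |l * (xl - yl)| + |(x * |x| ^ (q - 2) - y * |y| ^ (q - 2))| * |l * yl|) := by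
        gcongr
        refine (abs_add_le _ _).trans ?_
        rw [abs_mul (x * |x| ^ (q - 2)), abs_mul (x * |x| ^ (q - 2) - y * |y| ^ (q - 2))]
    _ ≤ q * (m ^ (q - 1) * δ + (q - 1) * m ^ (q - 2) * (δ / (1 + l)) * B) := by
        have a3 : |(x * |x| ^ (q - 2) - y * |y| ^ (q - 2))| ≤ (q - 1) * m ^ (q - 2) * (δ / (1 + l)) :=
          a2.trans (by gcongr)
        gcongr
    _ = _ := by linear_combination (q * (q - 1)) * c2

lemma key_ineq (q l s : ℝ) (hq : 2 < q) (hl : 0 ≤ l) (hs : 0 ≤ s) :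
    (1 + l) ^ (1 - q) * (1 + |l - s|) ^ (-q) * (1 + l + s) ^ (q - 1)
      ≤ 3 ^ q * ((1 + |s - l|) ^ (-2 : ℝ) + (1 + l + s)⁻¹) := by
  rw [abs_sub_comm s l]
  set d := 1 + |l - s| with hd
  have d1 : 1 ≤ d := by have := abs_nonneg (l - s); linarith
  set e := 1 + l + s with he
  have e1 : 1 ≤ e := by linarith
  have L1 : 1 ≤ 1 + l := by linarith
  rcases le_or_gt s (2 * l) with h | h
  · have h3 : e / 3 ≤ 1 + l := by rw [he]; linarith
    have a1 : (1 + l) ^ (1 - q) ≤ (e / 3) ^ (1 - q) :=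
      Real.rpow_le_rpow_of_nonpos (by positivity) h3 (by linarith)
    have a2 : d ^ (-q) ≤ d ^ (-2 : ℝ) := Real.rpow_le_rpow_of_exponent_le d1 (by linarith)
    have a3 : (e / 3) ^ (1 - q) * e ^ (q - 1) = 3 ^ (q - 1) := by
      rw [Real.div_rpow (by positivity) (by norm_num), div_mul_eq_mul_div, ← Real.rpow_add (by positivity)]
      rw [show 1 - q + (q - 1) = 0 by ring, Real.rpow_zero, show 1 - q = -(q - 1) by ring,
        Real.rpow_neg (by norm_num), one_div, inv_inv]
    have a4 : (3:ℝ) ^ (q - 1) ≤ 3 ^ q := Real.rpow_le_rpow_of_exponent_le (by norm_num) (by linarith)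
    calc _ ≤ (e / 3) ^ (1 - q) * d ^ (-2 : ℝ) * e ^ (q - 1) := by gcongr
      _ = 3 ^ (q - 1) * d ^ (-2 : ℝ) := by rw [← a3]; ring
      _ ≤ 3 ^ q * (d ^ (-2 : ℝ) + e⁻¹) := by
        gcongr
        have : 0 ≤ e⁻¹ := by positivity
        linarith
  · have h3 : e / 3 ≤ d := by
      rw [he, hd, abs_sub_comm, abs_of_pos (by linarith : 0 < s - l)]; linarith
    have a1 : (1 + l) ^ (1 - q) ≤ 1 := Real.rpow_le_one_of_one_le_of_nonpos L1 (by linarith)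
    have a2 : d ^ (-q) ≤ (e / 3) ^ (-q) := Real.rpow_le_rpow_of_nonpos (by positivity) h3 (by linarith)
    have a3 : (e / 3) ^ (-q) * e ^ (q - 1) = 3 ^ q * e⁻¹ := by
      rw [Real.div_rpow (by positivity) (by norm_num), div_mul_eq_mul_div, ← Real.rpow_add (by positivity)]
      rw [show -q + (q - 1) = -1 by ring, Real.rpow_neg_one, Real.rpow_neg (by norm_num)]
      field_simp
    calc _ ≤ 1 * (e / 3) ^ (-q) * e ^ (q - 1) := by gcongr
      _ = 3 ^ q * e⁻¹ := by rw [← a3]; ring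
      _ ≤ 3 ^ q * (d ^ (-2 : ℝ) + e⁻¹) := by
        gcongr
        have : 0 ≤ d ^ (-2 : ℝ) := by positivity
        linarith

lemma weight_est (q κ ν b E N l s : ℝ) (hq : 2 < q) (hl : 0 ≤ l) (hs : 0 ≤ s) (hE : 0 ≤ E) (hN : 0 ≤ N)
    (hb : b = ν + κ * (q - 1) - 1) :
    (E * (1 + l + s) ^ (1 - κ) * (1 + |l - s|)⁻¹ / (1 + l)) ^ (q - 1) *
      (N * (1 + l + s) ^ (1 - ν) * (1 + |l - s|)⁻¹) ≤ 3 ^ q * E ^ (q - 1) * N * gw b l s := by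
  have k := key_ineq q l s hq hl hs
  unfold gw
  rw [abs_of_nonneg hl]
  set d := 1 + |l - s| with hd
  have d1 : 1 ≤ d := by have := abs_nonneg (l - s); linarith
  set e := 1 + l + s with he
  have e1 : 1 ≤ e := by linarith
  have L1 : 1 ≤ 1 + l := by linarith
  have q1 : 0 ≤ q - 1 := by linarith
  have d0 : 0 < d := by linarith
  have e0 : 0 < e := by linarith
  have L0 : 0 < 1 + l := by linarith
  have x1 : (E * e ^ (1 - κ) * d⁻¹ / (1 + l)) ^ (q - 1) =
      E ^ (q - 1) * e ^ ((1 - κ) * (q - 1)) * d ^ (-(q - 1)) * (1 + l) ^ (1 - q) := by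
    rw [Real.div_rpow (by positivity) L0.le, Real.mul_rpow (by positivity) (by positivity),
      Real.mul_rpow hE (by positivity), ← Real.rpow_mul e0.le, Real.inv_rpow d0.le, ← Real.rpow_neg d0.le,
      show 1 - q = -(q - 1) by ring, Real.rpow_neg L0.le, div_eq_mul_inv]
  have x2 : d ^ (-(q - 1)) * d⁻¹ = d ^ (-q) := by
    rw [← Real.rpow_neg_one, ← Real.rpow_add d0]; ring_nf
  have x3 : e ^ ((1 - κ) * (q - 1)) * e ^ (1 - ν) = e ^ (q - 1) * e ^ (-b) := by
    rw [← Real.rpow_add e0, ← Real.rpow_add e0, hb]; ring_nf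
  have : (E * e ^ (1 - κ) * d⁻¹ / (1 + l)) ^ (q - 1) * (N * e ^ (1 - ν) * d⁻¹)
     = (E ^ (q - 1) * N * e ^ (-b)) * ((1 + l) ^ (1 - q) * d ^ (-q) * e ^ (q - 1)) := by
    rw [x1]
    calc _ = E ^ (q - 1) * (e ^ ((1 - κ) * (q - 1)) * e ^ (1 - ν)) * (d ^ (-(q - 1)) * d⁻¹) * (1 + l) ^ (1 - q) * N := by ring
      _ = _ := by rw [x2, x3]; ring
  rw [this]
  calc _ ≤ (E ^ (q - 1) * N * e ^ (-b)) * (3 ^ q * ((1 + |s - l|) ^ (-2 : ℝ) + e⁻¹)) := by gcongr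
    _ = _ := by ring

lemma isOpen_half : IsOpen ((Set.univ : Set ℝ) ×ˢ Set.Ioi (0:ℝ)) := isOpen_univ.prod isOpen_Ioi

lemma halfplane_sub : ((Set.univ : Set ℝ) ×ˢ Set.Ioi (0:ℝ)) ⊆ Set.univ ×ˢ Set.Ici (0:ℝ) :=
  Set.prod_mono le_rfl Set.Ioi_subset_Ici_self

lemma hasDerivAt_slice_t (f : ℝ × ℝ → ℝ) (r t : ℝ) (hf : DifferentiableAt ℝ f (r, t)) :
    HasDerivAt (fun t' => f (r, t')) (fderiv ℝ f (r, t) (0, 1)) t := by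
  have h2 : HasDerivAt (fun t' : ℝ => (r, t')) ((0:ℝ), (1:ℝ)) t :=
    (hasDerivAt_const t r).prodMk (hasDerivAt_id t)
  exact hf.hasFDerivAt.comp_hasDerivAt t h2

section reg
variable {u : ℝ → ℝ → ℝ} (hu : memX 2 u)
include hu

lemma reg_c1 : ContDiffOn ℝ 1 (fun z : ℝ × ℝ => u z.1 z.2) (Set.univ ×ˢ Set.Ioi (0:ℝ)) := by
  have := hu.1.mono halfplane_sub
  simpa using this

lemma reg_c2 : ContDiffOn ℝ 2 (fun z : ℝ × ℝ => z.1 * u z.1 z.2) (Set.univ ×ˢ Set.Ioi (0:ℝ)) := by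
  have := hu.2.1.mono halfplane_sub
  simpa using this

lemma reg_dat (r t : ℝ) (ht : 0 < t) : DifferentiableAt ℝ (fun z : ℝ × ℝ => u z.1 z.2) (r, t) :=
  ((reg_c1 hu).differentiableOn (by norm_num)).differentiableAt
    (isOpen_half.mem_nhds ⟨trivial, ht⟩)

lemma reg_pdt (r t : ℝ) (ht : 0 < t) :
    HasDerivAt (fun t' => u r t') (pdt u r t) t :=
  (hasDerivAt_slice_t _ r t (reg_dat hu r t ht)).differentiableAt.hasDerivAt

lemma reg_cont : ContinuousOn (fun z : ℝ × ℝ => pdt u z.1 z.2) (Set.univ ×ˢ Set.Ioi (0:ℝ)) := by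
  have h := (reg_c1 hu).continuousOn_fderiv_of_isOpen isOpen_half (by norm_num)
  have h2 : ContinuousOn (fun z : ℝ × ℝ => fderiv ℝ (fun z : ℝ × ℝ => u z.1 z.2) z (0, 1))
    (Set.univ ×ˢ Set.Ioi (0:ℝ)) := h.clm_apply continuousOn_const
  refine h2.congr ?_
  rintro ⟨r, t⟩ ⟨-, ht⟩
  exact (hasDerivAt_slice_t _ r t (reg_dat hu r t ht)).deriv

lemma reg_mul_dr (r t : ℝ) (ht : 0 < t) : DifferentiableAt ℝ (fun x => x * pdt u x t) r := by
  have h := (reg_c2 hu).fderiv_of_isOpen (m := 1) isOpen_half (by norm_num)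
  have h1 : DifferentiableAt ℝ (fderiv ℝ (fun z : ℝ × ℝ => z.1 * u z.1 z.2)) (r, t) :=
    (h.differentiableOn (by norm_num)).differentiableAt (isOpen_half.mem_nhds ⟨trivial, ht⟩)
  have h2 : DifferentiableAt ℝ (fun x : ℝ => fderiv ℝ (fun z : ℝ × ℝ => z.1 * u z.1 z.2) (x, t)) r :=
    DifferentiableAt.comp (f := fun x : ℝ => (x, t)) r h1 (by fun_prop)
  have h3 : DifferentiableAt ℝ (fun x : ℝ => fderiv ℝ (fun z : ℝ × ℝ => z.1 * u z.1 z.2) (x, t) (0, 1)) r :=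
    h2.clm_apply (differentiableAt_const _)
  have e : (fun x : ℝ => fderiv ℝ (fun z : ℝ × ℝ => z.1 * u z.1 z.2) (x, t) (0, 1)) = fun x => x * pdt u x t := by
    ext x
    have d : DifferentiableAt ℝ (fun z : ℝ × ℝ => z.1 * u z.1 z.2) (x, t) :=
      ((reg_c2 hu).differentiableOn (by norm_num)).differentiableAt (isOpen_half.mem_nhds ⟨trivial, ht⟩)
    exact (hasDerivAt_slice_t _ x t d).unique ((reg_pdt hu x t ht).const_mul x)
  rwa [e] at h3

lemma reg_dr (r t : ℝ) (hr : r ≠ 0) (ht : 0 < t) :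
    HasDerivAt (fun x => pdt u x t) (pdr (pdt u) r t) r := by
  have h1 := (reg_mul_dr hu r t ht).div differentiableAt_id hr
  have h2 : DifferentiableAt ℝ (fun x => pdt u x t) r := by
    refine h1.congr_of_eventuallyEq ?_
    filter_upwards [isOpen_ne.mem_nhds hr] with x hx
    have hx : x ≠ 0 := hx
    simp only [Pi.div_apply, id]
    field_simp
  exact h2.hasDerivAt

lemma reg_even (r t : ℝ) (ht : 0 < t) : pdt u (-r) t = pdt u r t := by
  unfold pdt
  apply EventuallyEq.deriv_eq
  filter_upwards [lt_mem_nhds ht] with x hx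
  exact hu.2.2 r x hx.le

lemma reg_cont_r (t : ℝ) (ht : 0 < t) : Continuous (fun x => pdt u x t) := by
  have h1 : ContinuousOn (fun x => pdt u x t) Set.univ :=
    (reg_cont hu).comp (f := fun x : ℝ => (x, t)) (by fun_prop) (fun x _ => ⟨trivial, ht⟩)
  exact continuousOn_univ.1 h1

end reg

lemma reg_sub {u v : ℝ → ℝ → ℝ} (hu : memX 2 u) (hv : memX 2 v) (r t : ℝ) (ht : 0 < t) :
    pdt (u - v) r t = pdt u r t - pdt v r t :=
  ((reg_pdt hu r t ht).sub (reg_pdt hv r t ht)).deriv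

lemma reg_sub_dr {u v : ℝ → ℝ → ℝ} (hu : memX 2 u) (hv : memX 2 v) (r t : ℝ) (hr : r ≠ 0) (ht : 0 < t) :
    pdr (pdt (u - v)) r t = pdr (pdt u) r t - pdr (pdt v) r t := by
  have e : (fun x => pdt (u - v) x t) = (fun x => pdt u x t) - fun x => pdt v x t := by
    ext x; exact reg_sub hu hv x t ht
  have := ((reg_dr hu r t hr ht).sub (reg_dr hv r t hr ht)).deriv
  rw [← e] at this
  exact this

/-! norms -/

lemma bracketS_nonneg (n : ℕ) (u : ℝ → ℝ → ℝ) (r t : ℝ) (hr : 0 < r) : 0 ≤ bracketS n u r t := by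
  unfold bracketS bracket1 bracket2
  split_ifs <;> positivity

lemma Znorm_nonneg (n : ℕ) (ν : ℝ) (u : ℝ → ℝ → ℝ) : 0 ≤ Znorm n ν u := by
  apply Real.sSup_nonneg
  rintro x ⟨r, t, hr, ht, rfl⟩
  have := bracketS_nonneg n u r t hr
  positivity

lemma Zbound (n : ℕ) (ν : ℝ) (u : ℝ → ℝ → ℝ) (hB : BddAbove (ZSet n ν u)) (r t : ℝ) (hr : 0 < r) (ht : 0 ≤ t) :
    bracketS n u r t ≤ Znorm n ν u * (1 + r + t) ^ (1 - ν) * (1 + |r - t|)⁻¹ := by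
  have h := le_csSup hB ⟨r, t, hr, ht, rfl⟩
  have e0 : 0 < 1 + r + t := by linarith
  have d0 : 0 < 1 + |r - t| := by positivity
  change _ ≤ Znorm n ν u at h
  have e1 : (1 + r + t) ^ (ν - 1) * (1 + r + t) ^ (1 - ν) = 1 := by
    rw [← Real.rpow_add e0]; simp
  calc bracketS n u r t = (bracketS n u r t * (1 + r + t) ^ (ν - 1) * (1 + |r - t|)) *
        (1 + r + t) ^ (1 - ν) * (1 + |r - t|)⁻¹ := by
        field_simp
        linear_combination -bracketS n u r t * e1
    _ ≤ _ := by gcongr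

lemma Zset_le (n : ℕ) (b : ℝ) (R : ℝ → ℝ → ℝ) (M : ℝ)
    (h : ∀ r t, 0 < r → 0 ≤ t → bracketS n R r t ≤ M * wt b r t) :
    BddAbove (ZSet n b R) ∧ Znorm n b R ≤ M := by
  have h1 : ∀ x ∈ ZSet n b R, x ≤ M := by
    rintro x ⟨r, t, hr, ht, rfl⟩
    have e0 : 0 < 1 + r + t := by linarith
    have d0 : 0 < 1 + |r - t| := by positivity
    have e1 : (1 + r + t) ^ (1 - b) * (1 + r + t) ^ (b - 1) = 1 := by
      rw [← Real.rpow_add e0]; simp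
    calc _ ≤ M * wt b r t * (1 + r + t) ^ (b - 1) * (1 + |r - t|) := by
          gcongr; exact h r t hr ht
      _ = M := by
          unfold wt
          field_simp
          linear_combination M * e1
  exact ⟨⟨M, h1⟩, csSup_le ⟨_, 1, 0, one_pos, le_rfl, rfl⟩ h1⟩

lemma bdd_one_of_two (ν : ℝ) (u : ℝ → ℝ → ℝ) (hB : BddAbove (ZSet 2 ν u)) : BddAbove (ZSet 1 ν u) := by
  obtain ⟨M, hM⟩ := hB
  refine ⟨M, ?_⟩
  rintro x ⟨r, t, hr, ht, rfl⟩
  refine le_trans ?_ (hM ⟨r, t, hr, ht, rfl⟩)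
  have e0 : 0 < 1 + r + t := by linarith
  have : bracketS 1 u r t ≤ bracketS 2 u r t := by
    simp only [bracketS, bracket1, bracket2]
    norm_num
    have a := abs_nonneg (pdr u r t)
    have b := abs_nonneg (pdt u r t)
    have : 0 ≤ r * (|pdr (pdr u) r t| + |pdr (pdt u) r t| + |pdt (pdt u) r t|) := by positivity
    nlinarith
  gcongr

lemma br1_dt (u : ℝ → ℝ → ℝ) (r t : ℝ) (hr : 0 < r) : r * |pdt u r t| ≤ bracketS 1 u r t := by
  simp only [bracketS, bracket1, if_true]
  have : 0 ≤ |u r t| + r * |pdr u r t| := by positivity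
  nlinarith

lemma br2_dt (u : ℝ → ℝ → ℝ) (r t : ℝ) (hr : 0 < r) : (1 + r) * |pdt u r t| ≤ bracketS 2 u r t := by
  simp only [bracketS, bracket2]
  norm_num
  have : 0 ≤ |u r t| + (1 + r) * |pdr u r t| + r * (|pdr (pdr u) r t| + |pdr (pdt u) r t| + |pdt (pdt u) r t|) := by positivity
  nlinarith

lemma br2_drt (u : ℝ → ℝ → ℝ) (r t : ℝ) (hr : 0 < r) : r * |pdr (pdt u) r t| ≤ bracketS 2 u r t := by
  simp only [bracketS, bracket2]
  norm_num
  have : 0 ≤ |u r t| + (1 + r) * (|pdr u r t| + |pdt u r t|) + r * (|pdr (pdr u) r t| + |pdt (pdt u) r t|) := by positivity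
  nlinarith

def Hf (q : ℝ) (u v : ℝ → ℝ → ℝ) (l s : ℝ) : ℝ := |pdt u l s| ^ q - |pdt v l s| ^ q
def Gt (q : ℝ) (u v : ℝ → ℝ → ℝ) (l s : ℝ) : ℝ := if 0 < s then l * Hf q u v l s else 0
def Gd (q : ℝ) (u v : ℝ → ℝ → ℝ) (l s : ℝ) : ℝ := deriv (fun x => Gt q u v x s) l

section main
variable {q : ℝ} {u v : ℝ → ℝ → ℝ}

lemma Rop_eq (r t : ℝ) (ht : 0 ≤ t) : Rop (NLt q u - NLt q v) r t = Ut (Gt q u v) r t := by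
  unfold Rop Ut Vint
  congr 1
  apply setIntegral_congr_fun measurableSet_Ioi
  intro s hs
  have hs' : 0 < s := lt_of_le_of_lt ht hs
  simp only [Gt, if_pos hs', Hf, NLt, Pi.sub_apply]

variable (hq : 2 < q) (hu : memX 2 u) (hv : memX 2 v)
include hq hu hv

lemma Hf_cont : ContinuousOn (fun z : ℝ × ℝ => Hf q u v z.1 z.2) (Set.univ ×ˢ Set.Ioi (0:ℝ)) := by
  have q0 : 0 ≤ q := by linarith
  exact ((reg_cont hu).abs.rpow_const (fun _ _ => Or.inr q0)).sub
    ((reg_cont hv).abs.rpow_const (fun _ _ => Or.inr q0))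

lemma Hf_cont_r (s : ℝ) (hs : 0 < s) : Continuous (fun x => Hf q u v x s) := by
  have q0 : 0 ≤ q := by linarith
  exact ((reg_cont_r hu s hs).abs.rpow_const (fun _ => Or.inr q0)).sub
    ((reg_cont_r hv s hs).abs.rpow_const (fun _ => Or.inr q0))

lemma Gt_odd (l s : ℝ) : Gt q u v (-l) s = - Gt q u v l s := by
  unfold Gt Hf
  split_ifs with h
  · rw [reg_even hu l s h, reg_even hv l s h]; ring
  · simp

lemma Gd_even (l s : ℝ) : Gd q u v (-l) s = Gd q u v l s := by
  have h := deriv_comp_neg (fun x => Gt q u v x s) l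
  have e : (fun x => Gt q u v (-x) s) = fun x => - Gt q u v x s := by
    ext x; exact Gt_odd hq hu hv x s
  have h2 : deriv (fun x => Gt q u v (-x) s) l = - Gd q u v (-l) s := h
  rw [e, deriv.fun_neg] at h2
  unfold Gd at *
  linarith

lemma Hf_der (l s : ℝ) (hl : l ≠ 0) (hs : 0 < s) : HasDerivAt (fun x => Hf q u v x s)
    (q * (pdt u l s * |pdt u l s| ^ (q - 2)) * pdr (pdt u) l s
      - q * (pdt v l s * |pdt v l s| ^ (q - 2)) * pdr (pdt v) l s) l := by
  have h1 := (hasDerivAt_abs_rpow (pdt u l s) (by linarith : 1 < q)).comp l (reg_dr hu l s hl hs)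
  have h2 := (hasDerivAt_abs_rpow (pdt v l s) (by linarith : 1 < q)).comp l (reg_dr hv l s hl hs)
  refine (h1.sub h2).congr_deriv ?_
  ring

lemma Gt_pos_eq (s : ℝ) (hs : 0 < s) : (fun x => Gt q u v x s) = fun x => x * Hf q u v x s := by
  ext x; simp [Gt, hs]

lemma Gt_der0 (s : ℝ) (hs : 0 < s) : HasDerivAt (fun x => Gt q u v x s) (Hf q u v 0 s) 0 := by
  rw [Gt_pos_eq hq hu hv s hs]
  exact hasDerivAt_id_mul_zero (fun x => Hf q u v x s) (Hf_cont_r hq hu hv s hs).continuousAt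

lemma Gt_der1 (l s : ℝ) (hl : l ≠ 0) (hs : 0 < s) : HasDerivAt (fun x => Gt q u v x s)
    (Hf q u v l s + l * (q * (pdt u l s * |pdt u l s| ^ (q - 2)) * pdr (pdt u) l s
      - q * (pdt v l s * |pdt v l s| ^ (q - 2)) * pdr (pdt v) l s)) l := by
  rw [Gt_pos_eq hq hu hv s hs]
  refine ((hasDerivAt_id l).mul (Hf_der hq hu hv l s hl hs)).congr_deriv ?_
  simp

lemma Gt_der (l s : ℝ) : HasDerivAt (fun x => Gt q u v x s) (Gd q u v l s) l := by
  have : DifferentiableAt ℝ (fun x => Gt q u v x s) l := by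
    by_cases hs : 0 < s
    · by_cases hl : l = 0
      · rw [hl]; exact (Gt_der0 hq hu hv s hs).differentiableAt
      · exact (Gt_der1 hq hu hv l s hl hs).differentiableAt
    · simp [Gt, hs]
  exact this.hasDerivAt

lemma Gt_meas : Measurable (Function.uncurry (Gt q u v)) := by
  classical
  have hm : MeasurableSet ((Set.univ : Set ℝ) ×ˢ Set.Ioi (0:ℝ)) := isOpen_half.measurableSet
  have h1 : ContinuousOn (fun z : ℝ × ℝ => z.1 * Hf q u v z.1 z.2) (Set.univ ×ˢ Set.Ioi (0:ℝ)) :=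
    continuousOn_fst.mul (Hf_cont hq hu hv)
  have h2 := h1.measurable_piecewise (g := fun _ => (0:ℝ)) continuousOn_const hm
  have e : Function.uncurry (Gt q u v) = ((Set.univ : Set ℝ) ×ˢ Set.Ioi (0:ℝ)).piecewise
      (fun z : ℝ × ℝ => z.1 * Hf q u v z.1 z.2) (fun _ => (0:ℝ)) := by
    ext ⟨l, s⟩
    simp [Function.uncurry, Gt, Set.piecewise]
  rw [e]; exact h2

lemma Gt_cont (ρ t : ℝ) (ht : 0 < t) : ContinuousAt (fun s => Gt q u v (s - t + ρ) s) t := by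
  have h1 : ContinuousOn (fun z : ℝ × ℝ => z.1 * Hf q u v z.1 z.2) (Set.univ ×ˢ Set.Ioi (0:ℝ)) :=
    continuousOn_fst.mul (Hf_cont hq hu hv)
  have h2 : ContinuousAt (fun z : ℝ × ℝ => z.1 * Hf q u v z.1 z.2) (t - t + ρ, t) :=
    h1.continuousAt (isOpen_half.mem_nhds ⟨trivial, ht⟩)
  have h3 : ContinuousAt (fun s : ℝ => (s - t + ρ) * Hf q u v (s - t + ρ) s) t :=
    ContinuousAt.comp (f := fun s : ℝ => (s - t + ρ, s)) h2 (by fun_prop)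
  refine h3.congr ?_
  filter_upwards [lt_mem_nhds ht] with x hx
  simp [Gt, hx]

end main

lemma gw_nonneg' (b l s : ℝ) (hs : 0 ≤ s) : 0 ≤ gw b l s := by
  unfold gw; positivity

lemma gw_cont (b s : ℝ) (hs : 0 < s) : Continuous (fun l => gw b l s) := by
  unfold gw
  have h1 : ∀ x : ℝ, 1 + |x| + s ≠ 0 := fun x => by positivity
  have h2 : ∀ x : ℝ, 1 + |s - abs x| ≠ 0 := fun x => by positivity
  refine Continuous.mul ?_ (Continuous.add ?_ ?_)
  · exact Continuous.rpow_const (by fun_prop) (fun x => Or.inl (h1 x))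
  · exact Continuous.rpow_const (by fun_prop) (fun x => Or.inl (h2 x))
  · exact Continuous.inv₀ (by fun_prop) h1

lemma gw_neg (b l s : ℝ) : gw b (-l) s = gw b l s := by
  unfold gw; rw [abs_neg]

section main
variable {q κ ν b E : ℝ} {u v : ℝ → ℝ → ℝ}

/-- constant in the pointwise estimates -/
def C3 (q : ℝ) : ℝ := (q + q ^ 2) * 3 ^ q

variable (hq : 2 < q) (hu : memZnu 2 κ u) (hv : memZnu 2 κ v) (hw : memZnu 2 ν (u - v))
  (hE : Znorm 2 κ u + Znorm 2 κ v ≤ E) (hb : b = ν + κ * (q - 1) - 1)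
include hq hu hv hw hE hb

lemma E_nonneg : 0 ≤ E := by
  have := Znorm_nonneg 2 κ u
  have := Znorm_nonneg 2 κ v
  linarith

lemma u_bd (l s : ℝ) (hl : 0 < l) (hs : 0 < s) :
    bracketS 2 u l s ≤ E * (1 + l + s) ^ (1 - κ) * (1 + |l - s|)⁻¹ ∧
    bracketS 2 v l s ≤ E * (1 + l + s) ^ (1 - κ) * (1 + |l - s|)⁻¹ := by
  have n1 := Znorm_nonneg 2 κ u
  have n2 := Znorm_nonneg 2 κ v
  have e0 : 0 < 1 + l + s := by linarith
  constructor
  · refine (Zbound 2 κ u hu.2 l s hl hs.le).trans ?_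
    gcongr
    linarith
  · refine (Zbound 2 κ v hv.2 l s hl hs.le).trans ?_
    gcongr
    linarith

lemma H_bd (l s x : ℝ) (N : ℝ) (hN : 0 ≤ N) (hl : 0 < l) (hs : 0 < s) (hx : 0 ≤ x)
    (hd : x * |pdt (u - v) l s| ≤ N * (1 + l + s) ^ (1 - ν) * (1 + |l - s|)⁻¹) :
    x * |Hf q u v l s| ≤ q * 3 ^ q * E ^ (q - 1) * N * gw b l s := by
  obtain ⟨h1, h2⟩ := u_bd hq hu hv hw hE hb l s hl hs
  have e := E_nonneg hq hu hv hw hE hb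
  have wtE := weight_est q κ ν b E N l s hq hl.le hs.le e hN hb
  have L : 0 < 1 + l := by linarith
  set B := E * (1 + l + s) ^ (1 - κ) * (1 + |l - s|)⁻¹ with hB
  have hx' : |pdt u l s| ≤ B / (1 + l) := by
    rw [le_div_iff₀ L]; have := br2_dt u l s hl; linarith
  have hy' : |pdt v l s| ≤ B / (1 + l) := by
    rw [le_div_iff₀ L]; have := br2_dt v l s hl; linarith
  have k := abs_rpow_sub_le q (by linarith) _ _ _ hx' hy'
  rw [reg_sub hu.1 hv.1 l s hs] at hd
  have q0 : 0 < q := by linarith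
  have hB0 : 0 ≤ B / (1 + l) := (abs_nonneg _).trans hx'
  calc _ ≤ x * (q * (B / (1 + l)) ^ (q - 1) * |pdt u l s - pdt v l s|) := by
        unfold Hf; gcongr
    _ = q * ((B / (1 + l)) ^ (q - 1) * (x * |pdt u l s - pdt v l s|)) := by ring
    _ ≤ q * (3 ^ q * E ^ (q - 1) * N * gw b l s) := by
        refine mul_le_mul_of_nonneg_left (le_trans ?_ wtE) q0.le
        gcongr
    _ = _ := by ring

lemma G1_bd (l s : ℝ) (hs : 0 < s) :
    |Gt q u v l s| ≤ C3 q * E ^ (q - 1) * Znorm 1 ν (u - v) * gw b l s := by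
  have e := E_nonneg hq hu hv hw hE hb
  have n := Znorm_nonneg 1 ν (u - v)
  have q0 : 0 < q := by linarith
  have main : ∀ l, 0 < l → |Gt q u v l s| ≤ C3 q * E ^ (q - 1) * Znorm 1 ν (u - v) * gw b l s := by
    intro l hl
    have := H_bd hq hu hv hw hE hb l s l (Znorm 1 ν (u - v)) n hl hs hl.le
      ((br1_dt _ l s hl).trans (Zbound 1 ν _ (bdd_one_of_two ν _ hw.2) l s hl hs.le))
    have g := gw_nonneg' b l s hs.le
    simp only [Gt, if_pos hs, abs_mul, abs_of_pos hl]
    refine this.trans ?_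
    unfold C3
    gcongr
    nlinarith
  rcases lt_trichotomy l 0 with h | h | h
  · have := main (-l) (by linarith)
    rwa [Gt_odd hq hu.1 hv.1, abs_neg, gw_neg] at this
  · subst h
    have g := gw_nonneg' b 0 s hs.le
    simp only [Gt, if_pos hs, zero_mul, abs_zero]
    unfold C3
    positivity
  · exact main l h

lemma G2_bd (l s : ℝ) (hs : 0 < s) :
    |Gt q u v l s| ≤ C3 q * E ^ (q - 1) * Znorm 2 ν (u - v) * gw b l s := by
  have e := E_nonneg hq hu hv hw hE hb
  have n := Znorm_nonneg 2 ν (u - v)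
  have q0 : 0 < q := by linarith
  have main : ∀ l, 0 < l → |Gt q u v l s| ≤ C3 q * E ^ (q - 1) * Znorm 2 ν (u - v) * gw b l s := by
    intro l hl
    have hd : l * |pdt (u - v) l s| ≤ bracketS 2 (u - v) l s := by
      have := br2_dt (u - v) l s hl
      have := abs_nonneg (pdt (u - v) l s)
      linarith
    have := H_bd hq hu hv hw hE hb l s l (Znorm 2 ν (u - v)) n hl hs hl.le
      (hd.trans (Zbound 2 ν _ hw.2 l s hl hs.le))
    have g := gw_nonneg' b l s hs.le
    simp only [Gt, if_pos hs, abs_mul, abs_of_pos hl]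
    refine this.trans ?_
    unfold C3
    gcongr
    nlinarith
  rcases lt_trichotomy l 0 with h | h | h
  · have := main (-l) (by linarith)
    rwa [Gt_odd hq hu.1 hv.1, abs_neg, gw_neg] at this
  · subst h
    have g := gw_nonneg' b 0 s hs.le
    simp only [Gt, if_pos hs, zero_mul, abs_zero]
    unfold C3
    positivity
  · exact main l h

lemma Gd_bd (l s : ℝ) (hs : 0 < s) :
    |Gd q u v l s| ≤ C3 q * E ^ (q - 1) * Znorm 2 ν (u - v) * gw b l s := by
  have e := E_nonneg hq hu hv hw hE hb
  set N := Znorm 2 ν (u - v) with hNdef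
  have n : 0 ≤ N := Znorm_nonneg 2 ν (u - v)
  have q0 : 0 < q := by linarith
  have hH : ∀ l, 0 < l → |Hf q u v l s| ≤ q * 3 ^ q * E ^ (q - 1) * N * gw b l s := by
    intro l hl
    have hd : 1 * |pdt (u - v) l s| ≤ bracketS 2 (u - v) l s := by
      have := br2_dt (u - v) l s hl
      have := mul_nonneg hl.le (abs_nonneg (pdt (u - v) l s))
      linarith
    have := H_bd hq hu hv hw hE hb l s 1 N n hl hs zero_le_one
      (hd.trans (Zbound 2 ν _ hw.2 l s hl hs.le))
    rwa [one_mul] at this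
  have main : ∀ l, 0 < l → |Gd q u v l s| ≤ C3 q * E ^ (q - 1) * N * gw b l s := by
    intro l hl
    obtain ⟨h1, h2⟩ := u_bd hq hu hv hw hE hb l s hl hs
    have wtE := weight_est q κ ν b E N l s hq hl.le hs.le e n hb
    have z := Zbound 2 ν _ hw.2 l s hl hs.le
    have k := point_est q hq l (E * (1 + l + s) ^ (1 - κ) * (1 + |l - s|)⁻¹)
      (N * (1 + l + s) ^ (1 - ν) * (1 + |l - s|)⁻¹) (pdt u l s) (pdt v l s)
      (pdr (pdt u) l s) (pdr (pdt v) l s) hl (by positivity)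
      ((br2_dt u l s hl).trans h1) ((br2_dt v l s hl).trans h2) ((br2_drt v l s hl).trans h2)
      (by rw [← reg_sub hu.1 hv.1 l s hs]; exact (br2_dt _ l s hl).trans z)
      (by rw [← reg_sub_dr hu.1 hv.1 l s hl.ne' hs]; exact (br2_drt _ l s hl).trans z)
    have d : Gd q u v l s = _ := (Gt_der1 hq hu.1 hv.1 l s hl.ne' hs).deriv
    rw [d]
    refine (abs_add_le _ _).trans ?_
    have k2 := k.trans (mul_le_mul_of_nonneg_left wtE (sq_nonneg q))
    have k1 := hH l hl
    unfold C3
    calc _ ≤ _ := add_le_add k1 k2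
      _ = _ := by ring
  rcases lt_trichotomy l 0 with h | h | h
  · have := main (-l) (by linarith)
    rwa [Gd_even hq hu.1 hv.1, gw_neg] at this
  · subst h
    have d : Gd q u v 0 s = _ := (Gt_der0 hq hu.1 hv.1 s hs).deriv
    rw [d]
    have c1 : Tendsto (fun l => |Hf q u v l s|) (𝓝[>] 0) (𝓝 |Hf q u v 0 s|) :=
      ((Hf_cont_r hq hu.1 hv.1 s hs).abs.tendsto 0).mono_left nhdsWithin_le_nhds
    have c2 : Tendsto (fun l => q * 3 ^ q * E ^ (q - 1) * N * gw b l s) (𝓝[>] 0)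
        (𝓝 (q * 3 ^ q * E ^ (q - 1) * N * gw b 0 s)) :=
      ((continuous_const.mul (gw_cont b s hs)).tendsto 0).mono_left nhdsWithin_le_nhds
    have := le_of_tendsto_of_tendsto c1 c2 (by
      filter_upwards [self_mem_nhdsWithin] with l hl using hH l hl)
    refine this.trans ?_
    have g := gw_nonneg' b 0 s hs.le
    unfold C3
    gcongr
    nlinarith
  · exact main l h

lemma good (hb1 : 1 < b) : GoodG b (C3 q * E ^ (q - 1) * Znorm 2 ν (u - v) * 2) (Gt q u v) (Gd q u v) := by
  have e := E_nonneg hq hu hv hw hE hb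
  have n := Znorm_nonneg 2 ν (u - v)
  have q0 : 0 < q := by linarith
  have c : 0 ≤ C3 q * E ^ (q - 1) * Znorm 2 ν (u - v) := by unfold C3; positivity
  refine ⟨hb1, Gt_odd hq hu.1 hv.1, Gt_der hq hu.1 hv.1, ?_, ?_, Gt_meas hq hu.1 hv.1, Gt_cont hq hu.1 hv.1⟩
  · intro l s
    by_cases hs : 0 < s
    · refine (G2_bd hq hu hv hw hE hb l s hs).trans ?_
      rw [mul_assoc _ (2:ℝ), abs_of_pos hs]
      exact mul_le_mul_of_nonneg_left (gw_le_crude b l s hb1 hs.le) c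
    · simp only [Gt, if_neg hs, abs_zero]
      positivity
  · intro l s
    by_cases hs : 0 < s
    · refine (Gd_bd hq hu hv hw hE hb l s hs).trans ?_
      rw [mul_assoc _ (2:ℝ), abs_of_pos hs]
      exact mul_le_mul_of_nonneg_left (gw_le_crude b l s hb1 hs.le) c
    · simp only [Gd, Gt, if_neg hs, deriv_const, abs_zero]
      positivity

lemma final1 (hb1 : 1 < b) :
    BddAbove (ZSet 1 b (Rop (NLt q u - NLt q v))) ∧
    Znorm 1 b (Rop (NLt q u - NLt q v)) ≤ 4 * C0 b * (C3 q * E ^ (q - 1) * Znorm 1 ν (u - v)) := by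
  have e := E_nonneg hq hu hv hw hE hb
  have n := Znorm_nonneg 1 ν (u - v)
  have q0 : 0 < q := by linarith
  apply Zset_le
  intro r t hr ht
  simp only [bracketS, if_true]
  exact br1_le (good hq hu hv hw hE hb hb1) (fun r t ht => Rop_eq r t ht) (by unfold C3; positivity)
    (G1_bd hq hu hv hw hE hb) r t hr ht

lemma final2 (hb1 : 1 < b) :
    BddAbove (ZSet 2 b (Rop (NLt q u - NLt q v))) ∧
    Znorm 2 b (Rop (NLt q u - NLt q v)) ≤ C2 b * (C3 q * E ^ (q - 1) * Znorm 2 ν (u - v)) := by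
  have e := E_nonneg hq hu hv hw hE hb
  have n := Znorm_nonneg 2 ν (u - v)
  have q0 : 0 < q := by linarith
  apply Zset_le
  intro r t hr ht
  simp only [bracketS]
  rw [if_neg (by norm_num)]
  exact br2_le (good hq hu hv hw hE hb hb1) (fun r t ht => Rop_eq r t ht) (by unfold C3; positivity)
    (G2_bd hq hu hv hw hE hb) (Gd_bd hq hu hv hw hE hb) r t hr ht

end main

end Helpers

/-- **Lemma 4.7, estimates (4.33)/(4.34).** Under the assumptions of Theorem 2.4:
if `u₁, u₁^* ∈ Z²(κ₁)`, `u₁ - u₁^* ∈ Z²(κ₁ a_{ℓ+1})` and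
`‖u₁‖_{Z²(κ₁)} + ‖u₁^*‖_{Z²(κ₁)} ≤ C ε` with `0 < ε ≤ 1`, then, with
`H(w,w^*) = |∂_t w|^q - |∂_t w^*|^q`,
`‖R(H(u₁,u₁^*))‖_{Z¹(a_{ℓ+2})} ≤ C' ε^{q-1} ‖u₁ - u₁^*‖_{Z¹(κ₁ a_{ℓ+1})}` and
`‖R(H(u₁,u₁^*))‖_{Z²(a_{ℓ+2})} ≤ C' ε^{q-1} ‖u₁ - u₁^*‖_{Z²(κ₁ a_{ℓ+1})}`. -/
theorem stmt17 (p q : ℝ) (hp1 : 1 < p) (hp2 : p < 2) (hpq : p ≤ q)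
    (hcond : (p - 1) ^ 2 * (q - 1) > 1) (ℓ : ℕ)
    (hl1 : 1 / (p - 1) < aseq (p - 1) (q * (p - 1) - 1) (ℓ + 1))
    (hl2 : aseq (p - 1) (q * (p - 1) - 1) ℓ ≤ 1 / (p - 1))
    (C : ℝ) (hC : 0 < C) :
    ∃ C' > 0, ∀ ε : ℝ, 0 < ε → ε ≤ 1 →
      ∀ u₁ u₁' : ℝ → ℝ → ℝ,
        memZnu 2 (p - 1) u₁ → memZnu 2 (p - 1) u₁' →
        memZnu 2 ((p - 1) * aseq (p - 1) (q * (p - 1) - 1) (ℓ + 1)) (u₁ - u₁') →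
        Znorm 2 (p - 1) u₁ + Znorm 2 (p - 1) u₁' ≤ C * ε →
        (BddAbove (ZSet 1 (aseq (p - 1) (q * (p - 1) - 1) (ℓ + 2))
            (Rop (NLt q u₁ - NLt q u₁'))) ∧
          Znorm 1 (aseq (p - 1) (q * (p - 1) - 1) (ℓ + 2))
            (Rop (NLt q u₁ - NLt q u₁')) ≤
            C' * ε ^ (q - 1) *
              Znorm 1 ((p - 1) * aseq (p - 1) (q * (p - 1) - 1) (ℓ + 1)) (u₁ - u₁')) ∧
        (BddAbove (ZSet 2 (aseq (p - 1) (q * (p - 1) - 1) (ℓ + 2))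
            (Rop (NLt q u₁ - NLt q u₁'))) ∧
          Znorm 2 (aseq (p - 1) (q * (p - 1) - 1) (ℓ + 2))
            (Rop (NLt q u₁ - NLt q u₁')) ≤
            C' * ε ^ (q - 1) *
              Znorm 2 ((p - 1) * aseq (p - 1) (q * (p - 1) - 1) (ℓ + 1))
                (u₁ - u₁')) := by
  have hk0 : 0 < p - 1 := by linarith
  have hk1 : p - 1 < 1 := by linarith
  have hq1 : 1 < q - 1 := by
    by_contra hcon
    have h1 : q - 1 ≤ 1 := not_lt.1 hcon
    have h2 : (p - 1) ^ 2 < 1 := by nlinarith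
    have h3 : 0 < (p - 1) ^ 2 := by positivity
    nlinarith
  have hq : 2 < q := by linarith
  have hkq : 1 < (p - 1) * (q - 1) := by nlinarith
  have hkA : 1 < (p - 1) * aseq (p - 1) (q * (p - 1) - 1) (ℓ + 1) := by
    rw [div_lt_iff₀ hk0] at hl1
    linarith
  have hb : aseq (p - 1) (q * (p - 1) - 1) (ℓ + 2) =
      (p - 1) * aseq (p - 1) (q * (p - 1) - 1) (ℓ + 1) + (p - 1) * (q - 1) - 1 := by
    change (p - 1) * (aseq (p - 1) (q * (p - 1) - 1) (ℓ + 1) - 1) + (q * (p - 1) - 1) = _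
    ring
  set b := aseq (p - 1) (q * (p - 1) - 1) (ℓ + 2) with hbdef
  have hb1 : 1 < b := by rw [hb]; linarith
  have c0 := C0_pos b hb1
  have c2 : 0 < C2 b := by unfold C2; positivity
  have c3 : 0 < C3 q := by unfold C3; positivity
  have cC : 0 < C ^ (q - 1) := by positivity
  refine ⟨(4 * C0 b + C2 b) * (C3 q * C ^ (q - 1)), by positivity, ?_⟩
  intro ε hε hε1 u v hu hv hw hE
  have f1 := final1 hq hu hv hw hE hb hb1
  have f2 := final2 hq hu hv hw hE hb hb1
  have n1 := Znorm_nonneg 1 ((p - 1) * aseq (p - 1) (q * (p - 1) - 1) (ℓ + 1)) (u - v)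
  have n2 := Znorm_nonneg 2 ((p - 1) * aseq (p - 1) (q * (p - 1) - 1) (ℓ + 1)) (u - v)
  have ee : (C * ε) ^ (q - 1) = C ^ (q - 1) * ε ^ (q - 1) := Real.mul_rpow hC.le hε.le
  rw [ee] at f1 f2
  have eε : 0 < ε ^ (q - 1) := by positivity
  refine ⟨⟨f1.1, f1.2.trans ?_⟩, ⟨f2.1, f2.2.trans ?_⟩⟩
  · calc _ = 4 * C0 b * (C3 q * C ^ (q - 1)) * ε ^ (q - 1) *
          Znorm 1 ((p - 1) * aseq (p - 1) (q * (p - 1) - 1) (ℓ + 1)) (u - v) := by ring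
      _ ≤ _ := by
        gcongr
        linarith
  · calc _ = C2 b * (C3 q * C ^ (q - 1)) * ε ^ (q - 1) *
          Znorm 2 ((p - 1) * aseq (p - 1) (q * (p - 1) - 1) (ℓ + 1)) (u - v) := by ring
      _ ≤ _ := by
        gcongr
        linarith
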